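/- Let C be a C*-algebra and let B ⊆ C be a closed *-subalgebra, such that both B and C have stable rank one and C has no K₁-obstructions. Then the C*-algebra A = {f ∈ C([0,1],C) : f(0) ∈ B} has stable rank one. -/

import Mathlib

noncomputable section

set_option maxHeartbeats 1000000

def StableRankOne (A : Type*) [NonUnitalCStarAlgebra A] : Prop :=
  Dense {x : Unitization ℂ A | IsUnit x}

def K1Trivial (B : Type*) [NonUnitalCStarAlgebra B] : Prop :=
  ∀ n : ℕ, 0 < n → ∀ u : unitary (Matrix (Fin n) (Fin n) (Unitization ℂ B)),
    ∃ (k : ℕ) (h : Matrix.fromBlocks u.1 0 0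
        (1 : Matrix (Fin k) (Fin k) (Unitization ℂ B)) ∈
        unitary (Matrix (Fin n ⊕ Fin k) (Fin n ⊕ Fin k) (Unitization ℂ B))),
      Joined (1 : unitary (Matrix (Fin n ⊕ Fin k) (Fin n ⊕ Fin k) (Unitization ℂ B)))
        ⟨Matrix.fromBlocks u.1 0 0 1, h⟩

def NoK1Obstructions (A : Type*) [NonUnitalCStarAlgebra A] : Prop :=
  StableRankOne A ∧
    ∀ (B : NonUnitalStarSubalgebra ℂ A) [IsClosed (B : Set A)],
      (∀ b ∈ B, ∀ a : A, ∀ b' ∈ B, b * a * b' ∈ B) → K1Trivial B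

/-- The C*-algebra `{f ∈ C([0,1], C) : f 0 ∈ B}`, as a closed *-subalgebra of `C([0,1], C)`. -/
def zeroFiber (Cst : Type*) [NonUnitalCStarAlgebra Cst] (B : NonUnitalStarSubalgebra ℂ Cst) :
    NonUnitalStarSubalgebra ℂ C(unitInterval, Cst) where
  carrier := {f : C(unitInterval, Cst) | f 0 ∈ B}
  add_mem' {f g} hf hg := by simpa using add_mem hf hg
  zero_mem' := by simpa using zero_mem B
  mul_mem' {f g} hf hg := by simpa using mul_mem hf hg
  smul_mem' c f hf := by simpa using SMulMemClass.smul_mem c hf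
  star_mem' {f} hf := by simpa using star_mem hf

instance zeroFiber_isClosed (Cst : Type*) [NonUnitalCStarAlgebra Cst]
    (B : NonUnitalStarSubalgebra ℂ Cst) [hB : IsClosed (B : Set Cst)] :
    IsClosed ((zeroFiber Cst B : Set C(unitInterval, Cst))) :=
  hB.preimage (continuous_eval_const 0)

theorem exists_sum_smul_approx {X E : Type*} [TopologicalSpace X] [CompactSpace X] [T2Space X]
    [NormedAddCommGroup E] [NormedSpace ℝ E] (f : C(X, E)) {ε : ℝ} (hε : 0 < ε) :
    ∃ (s : Finset X) (g : s → C(X, ℝ)), ∀ x, ‖∑ i, g i x • f i - f x‖ < ε := by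
  obtain ⟨s, hs⟩ := isCompact_univ.elim_finite_subcover (fun y : X => f ⁻¹' Metric.ball (f y) ε)
    (fun y => Metric.isOpen_ball.preimage f.continuous)
    (fun x _ => Set.mem_iUnion.2 ⟨x, by simpa using hε⟩)
  obtain ⟨ρ, hρ⟩ := PartitionOfUnity.exists_isSubordinate isClosed_univ
    (fun y : s => f ⁻¹' Metric.ball (f y) ε) (fun y => Metric.isOpen_ball.preimage f.continuous)
    (by simpa [Set.iUnion_subtype] using hs)
  refine ⟨s, ρ, fun x => ?_⟩
  have := ρ.finsum_smul_mem_convex (g := fun i _ => f i) (t := Metric.ball (f x) ε) (Set.mem_univ x)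
    (fun i hi => ?_) (convex_ball _ _)
  · rwa [finsum_eq_sum_of_fintype, Metric.mem_ball, dist_eq_norm] at this
  · have := hρ i (subset_tsupport _ hi)
    rwa [Set.mem_preimage, Metric.mem_ball, dist_comm, ← Metric.mem_ball] at this

section Loop

variable {R : Type*} [NormedRing R] [NormedAlgebra ℂ R]

def fourierMonomial (k : ℤ) : R →ₗ[ℂ] C(AddCircle (1 : ℝ), R) where
  toFun a := ⟨fun t => fourier k t • a, by fun_prop⟩
  map_add' a b := by ext; simp
  map_smul' c a := by ext t; exact smul_comm _ _ _

theorem fourierMonomial_apply (k : ℤ) (a : R) (t : AddCircle (1 : ℝ)) :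
    fourierMonomial k a t = fourier k t • a := rfl

theorem fourierMonomial_mul (k l : ℤ) (a b : R) :
    fourierMonomial k a * fourierMonomial l b = fourierMonomial (k + l) (a * b) := by
  ext t
  rw [ContinuousMap.mul_apply, fourierMonomial_apply, fourierMonomial_apply,
    fourierMonomial_apply, fourier_add, smul_mul_smul_comm]

theorem fourierMonomial_zero_one : fourierMonomial 0 (1 : R) = 1 := by
  ext t
  rw [fourierMonomial_apply, fourier_zero, one_smul, ContinuousMap.one_apply]

theorem isUnit_fourierMonomial (k : ℤ) {a : R} (ha : IsUnit a) : IsUnit (fourierMonomial k a) := by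
  obtain ⟨a, rfl⟩ := ha
  refine ⟨⟨fourierMonomial k a, fourierMonomial (-k) ↑a⁻¹, ?_, ?_⟩, rfl⟩ <;>
  simp [fourierMonomial_mul, fourierMonomial_zero_one]

theorem commute_fourierMonomial_one (k : ℤ) (f : C(AddCircle (1 : ℝ), R)) :
    Commute (fourierMonomial k (1 : R)) f := by
  ext t
  simp [fourierMonomial_apply]

variable (R) in
def fourierDegreeLT (n : ℕ) : Submodule ℂ C(AddCircle (1 : ℝ), R) :=
  Submodule.span ℂ {f | ∃ k : ℕ, k < n ∧ ∃ a, f = fourierMonomial k a}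

theorem fourierDegreeLT_zero : fourierDegreeLT R 0 = ⊥ := by
  simp [fourierDegreeLT]

theorem fourierMonomial_mem {k n : ℕ} (h : k < n) (a : R) :
    fourierMonomial k a ∈ fourierDegreeLT R n := Submodule.subset_span ⟨k, h, a, rfl⟩

theorem fourierDegreeLT_mono {m n : ℕ} (h : m ≤ n) : fourierDegreeLT R m ≤ fourierDegreeLT R n :=
  Submodule.span_mono fun _ ⟨k, hk, a, ha⟩ => ⟨k, by omega, a, ha⟩

theorem fourierMonomial_mul_mem {n : ℕ} (k : ℕ) (c : R) {p : C(AddCircle (1 : ℝ), R)}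
    (hp : p ∈ fourierDegreeLT R n) : fourierMonomial k c * p ∈ fourierDegreeLT R (k + n) := by
  induction hp using Submodule.span_induction with
  | mem x h =>
    obtain ⟨l, hl, a, rfl⟩ := h
    rw [fourierMonomial_mul, ← Nat.cast_add]
    exact fourierMonomial_mem (by omega) _
  | zero => simp
  | add x y _ _ hx hy => rw [mul_add]; exact add_mem hx hy
  | smul c x _ hx => rw [mul_smul_comm]; exact Submodule.smul_mem _ _ hx

theorem exists_sub_fourierMonomial_mem {n : ℕ} {p : C(AddCircle (1 : ℝ), R)}
    (hp : p ∈ fourierDegreeLT R (n + 1)) :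
    ∃ a, p - fourierMonomial n a ∈ fourierDegreeLT R n := by
  induction hp using Submodule.span_induction with
  | mem x h =>
    obtain ⟨l, hl, a, rfl⟩ := h
    rcases (Nat.lt_succ_iff_lt_or_eq.1 hl) with h | rfl
    · exact ⟨0, by simpa using fourierMonomial_mem h a⟩
    · exact ⟨a, by simp⟩
  | zero => exact ⟨0, by simp⟩
  | add x y _ _ hx hy =>
    obtain ⟨a, ha⟩ := hx
    obtain ⟨b, hb⟩ := hy
    exact ⟨a + b, by simpa [add_sub_add_comm] using add_mem ha hb⟩
  | smul c x _ hx =>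
    obtain ⟨a, ha⟩ := hx
    exact ⟨c • a, by simpa [smul_sub] using Submodule.smul_mem _ c ha⟩

variable (R) in
def fourierLaurent : Submodule ℂ C(AddCircle (1 : ℝ), R) :=
  Submodule.span ℂ {f | ∃ (k : ℤ) (a : R), f = fourierMonomial k a}

theorem exists_fourierMonomial_mul_mem {p : C(AddCircle (1 : ℝ), R)} (hp : p ∈ fourierLaurent R) :
    ∃ N : ℕ, ∀ N' : ℕ, N ≤ N' → ∃ M, fourierMonomial N' (1 : R) * p ∈ fourierDegreeLT R M := by
  induction hp using Submodule.span_induction with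
  | mem x h =>
    obtain ⟨l, a, rfl⟩ := h
    refine ⟨l.natAbs, fun N' hN => ⟨(N' + l).toNat + 1, ?_⟩⟩
    rw [fourierMonomial_mul, one_mul]
    convert fourierMonomial_mem (Nat.lt_succ_self (N' + l).toNat) a
    omega
  | zero => exact ⟨0, fun _ _ => ⟨0, by simp⟩⟩
  | add x y _ _ hx hy =>
    obtain ⟨N, hN⟩ := hx
    obtain ⟨K, hK⟩ := hy
    refine ⟨max N K, fun N' h => ?_⟩
    obtain ⟨M, hM⟩ := hN N' (by omega)
    obtain ⟨M', hM'⟩ := hK N' (by omega)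
    refine ⟨max M M', ?_⟩
    rw [mul_add]
    exact add_mem (fourierDegreeLT_mono (by omega) hM) (fourierDegreeLT_mono (by omega) hM')
  | smul c x _ hx =>
    obtain ⟨N, hN⟩ := hx
    refine ⟨N, fun N' h => ?_⟩
    obtain ⟨M, hM⟩ := hN N' h
    exact ⟨M, by rw [mul_smul_comm]; exact Submodule.smul_mem _ _ hM⟩

theorem dense_fourierLaurent : Dense (fourierLaurent R : Set C(AddCircle (1 : ℝ), R)) := by
  have key : ∀ (φ : C(AddCircle (1 : ℝ), ℂ)) (r : R),
      (⟨fun t => φ t • r, by fun_prop⟩ : C(AddCircle (1 : ℝ), R)) ∈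
        (fourierLaurent R).topologicalClosure := by
    intro φ r
    let Φ : C(AddCircle (1 : ℝ), ℂ) →ₗ[ℂ] C(AddCircle (1 : ℝ), R) :=
      { toFun := fun φ => ⟨fun t => φ t • r, by fun_prop⟩
        map_add' := fun a b => by ext; simp [add_smul]
        map_smul' := fun a b => by ext; simp [mul_smul] }
    have hΦ : Continuous Φ :=
      (Φ.mkContinuous ‖r‖ fun f => by
        rw [ContinuousMap.norm_le _ (by positivity)]
        intro x
        refine (norm_smul_le _ _).trans ?_
        rw [mul_comm]
        gcongr
        exact f.norm_coe_le_norm x).continuous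
    have h1 : Submodule.span ℂ (Set.range (@fourier 1)) ≤
        (fourierLaurent R).topologicalClosure.comap Φ := by
      rw [Submodule.span_le]
      rintro _ ⟨k, rfl⟩
      exact Submodule.le_topologicalClosure _ (Submodule.subset_span ⟨k, r, rfl⟩)
    have h2 := Submodule.topologicalClosure_minimal _ h1
      ((Submodule.isClosed_topologicalClosure (fourierLaurent R)).preimage hΦ)
    rw [span_fourier_closure_eq_top] at h2
    exact h2 (Submodule.mem_top (x := φ))
  intro f
  have : f ∈ closure ((fourierLaurent R).topologicalClosure : Set C(AddCircle (1 : ℝ), R)) := by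
    rw [Metric.mem_closure_iff]
    intro ε hε
    let _ : NormedSpace ℝ R := NormedSpace.restrictScalars ℝ ℂ R
    obtain ⟨s, g, hg⟩ := exists_sum_smul_approx f hε
    refine ⟨∑ i, ⟨fun t => ((g i t : ℝ) : ℂ) • f i, by fun_prop⟩, sum_mem fun i _ =>
      key ⟨fun t => (g i t : ℂ), by fun_prop⟩ (f i), ?_⟩
    rw [dist_comm, dist_eq_norm, ContinuousMap.norm_lt_iff _ hε]
    intro x
    simpa using hg x
  rwa [(Submodule.isClosed_topologicalClosure _).closure_eq] at this

end Loop

section ColumnOrbit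

variable {Q ι : Type*} [Fintype ι] [DecidableEq ι]

def columnOrbit (Q : Type*) [Ring Q] (l : ι) : Set (ι → Q) :=
  {v | ∃ F : (Matrix ι ι Q)ˣ, v = F.1.mulVec (Pi.single l 1)}

theorem mulVec_mem_closure_columnOrbit [Ring Q] [TopologicalSpace Q] [IsTopologicalRing Q]
    {l : ι} (G : (Matrix ι ι Q)ˣ) {v : ι → Q} (hv : v ∈ closure (columnOrbit Q l)) :
    G.1.mulVec v ∈ closure (columnOrbit Q l) := by
  refine map_mem_closure (f := fun v => G.1.mulVec v) (by fun_prop) hv ?_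
  rintro _ ⟨F, rfl⟩
  exact ⟨G * F, Matrix.mulVec_mulVec _ _ _⟩

theorem mul_unit_mem_closure_columnOrbit [Ring Q] [TopologicalSpace Q] [IsTopologicalRing Q]
    {l : ι} (a : Qˣ) {v : ι → Q} (hv : v ∈ closure (columnOrbit Q l)) :
    (fun i => v i * a) ∈ closure (columnOrbit Q l) := by
  refine map_mem_closure (f := fun (v : ι → Q) i => v i * a) (by fun_prop) hv ?_
  rintro _ ⟨F, rfl⟩
  refine ⟨F * Units.map (Matrix.scalar ι).toMonoidHom a, ?_⟩
  ext i
  simp [Matrix.mulVec_single]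

def transvectionUnit [Ring Q] {i j : ι} (h : i ≠ j) (c : Q) : (Matrix ι ι Q)ˣ where
  val := 1 + Matrix.single i j c
  inv := 1 - Matrix.single i j c
  val_inv := by simp [add_mul, mul_sub, Matrix.single_mul_single_of_ne, h.symm]
  inv_val := by simp [sub_mul, mul_add, Matrix.single_mul_single_of_ne, h.symm]

theorem transvectionUnit_mulVec_same [Ring Q] {i j : ι} (h : i ≠ j) (c : Q) (v : ι → Q) :
    (transvectionUnit h c).1.mulVec v i = v i + c * v j := by
  change (1 + Matrix.single i j c).mulVec v i = _
  rw [Matrix.add_mulVec, Matrix.one_mulVec]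
  simp [Matrix.mulVec, dotProduct, Matrix.single_apply]

theorem transvectionUnit_mulVec_of_ne [Ring Q] {i j k : ι} (h : i ≠ j) (hk : k ≠ i) (c : Q)
    (v : ι → Q) : (transvectionUnit h c).1.mulVec v k = v k := by
  change (1 + Matrix.single i j c).mulVec v k = _
  rw [Matrix.add_mulVec, Matrix.one_mulVec]
  simp [Matrix.mulVec, dotProduct, hk.symm]

theorem mem_columnOrbit_of_isUnit_same [Ring Q] {l : ι} {v : ι → Q} (h : IsUnit (v l)) :
    v ∈ columnOrbit Q l := by
  obtain ⟨a, ha⟩ := h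
  let e : ι → Q := Pi.single l 1
  have key : ∀ x y : ι → Q, (∀ k, x k + y k + x k * y l = 0) →
      (1 + Matrix.vecMulVec x e) * (1 + Matrix.vecMulVec y e) = 1 := by
    intro x y hxy
    ext i j
    have h0 : (x i + y i + x i * y l) * e j = 0 := by rw [hxy, zero_mul]
    have h1 : e ⬝ᵥ y = y l := by simp [e]
    rw [add_mul, add_mul] at h0
    simp only [mul_add, add_mul, mul_one, one_mul, Matrix.vecMulVec_mul_vecMulVec, h1,
      Matrix.add_apply, Matrix.vecMulVec_apply, Pi.smul_apply, smul_eq_mul, add_assoc] at h0 ⊢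
    rw [← mul_assoc, h0, add_zero]
  refine ⟨⟨1 + Matrix.vecMulVec (v - e) e,
    1 + Matrix.vecMulVec (fun k => (e k - v k) * ↑a⁻¹) e, key _ _ ?_, key _ _ ?_⟩, ?_⟩
  · intro k
    simp only [e, Pi.sub_apply, ← ha, Pi.single_eq_same, sub_mul, mul_sub, Units.mul_inv]
    simp
    abel
  · intro k
    simp only [e, Pi.sub_apply, ← ha, Pi.single_eq_same, sub_mul, mul_sub, mul_assoc,
      Units.inv_mul]
    simp
    abel
  · ext k
    simp [Matrix.vecMulVec_apply, Matrix.one_apply, e, Pi.single_apply]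

theorem mem_columnOrbit_of_isUnit [Ring Q] [TopologicalSpace Q] [IsTopologicalRing Q]
    {l i : ι} {v : ι → Q} (h : IsUnit (v i)) :
    v ∈ closure (columnOrbit Q l) := by
  rcases eq_or_ne l i with rfl | hl
  · exact subset_closure (mem_columnOrbit_of_isUnit_same h)
  obtain ⟨a, ha⟩ := h
  let T := transvectionUnit hl ((1 - v l) * ↑a⁻¹)
  have : T.1.mulVec v ∈ closure (columnOrbit Q l) := by
    refine subset_closure (mem_columnOrbit_of_isUnit_same ?_)
    rw [transvectionUnit_mulVec_same, ← ha]
    simp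
  simpa using mulVec_mem_closure_columnOrbit T⁻¹ this

end ColumnOrbit

section Euclid

variable {R ι : Type*} [NormedRing R] [NormedAlgebra ℂ R] [Fintype ι] [DecidableEq ι]

theorem mem_closure_columnOrbit_of_degree (hR : Dense {a : R | IsUnit a}) (l : ι) (s : ℕ) :
    ∀ (n m : ℕ) (i j : ι) (v : ι → C(AddCircle (1 : ℝ), R)), n + m = s → i ≠ j →
      v i ∈ fourierDegreeLT R (n + 1) → v j ∈ fourierDegreeLT R (m + 1) →
      v ∈ closure (columnOrbit C(AddCircle (1 : ℝ), R) l) := by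
  induction s using Nat.strong_induction_on with
  | _ s ih =>
  intro n m i j v hs hij hi hj
  wlog hnm : n ≤ m generalizing n m i j
  · exact this m n j i (by omega) hij.symm hj hi (by omega)
  obtain ⟨a, ha⟩ := exists_sub_fourierMonomial_mem hi
  let φ : R → ι → C(AddCircle (1 : ℝ), R) :=
    fun b => Function.update v i (v i - fourierMonomial n a + fourierMonomial n b)
  have hmono : Continuous fun b : R => fourierMonomial n b := by
    refine ContinuousMap.continuous_of_continuous_uncurry _ ?_
    simp only [Function.uncurry_def, fourierMonomial_apply]
    fun_prop
  have hφ : Continuous φ := continuous_const.update i (by fun_prop)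
  suffices H : ∀ b, φ b ∈ closure (columnOrbit C(AddCircle (1 : ℝ), R) l) by
    simpa [φ] using H a
  suffices H : {a : R | IsUnit a} ⊆ φ ⁻¹' closure (columnOrbit C(AddCircle (1 : ℝ), R) l) by
    intro b
    exact (isClosed_closure.preimage hφ).closure_subset_iff.2 H (hR b)
  intro b hb
  have hφj : φ b j = v j := Function.update_of_ne hij.symm _ _
  have hφi : φ b i = v i - fourierMonomial n a + fourierMonomial n b := Function.update_self _ _ _
  rcases Nat.eq_zero_or_pos n with rfl | hn
  · refine mem_columnOrbit_of_isUnit (i := i) ?_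
    rw [fourierDegreeLT_zero, Submodule.mem_bot] at ha
    rw [hφi, ha, zero_add]
    exact isUnit_fourierMonomial _ hb
  obtain ⟨b, rfl⟩ := hb
  obtain ⟨c, hc⟩ := exists_sub_fourierMonomial_mem hj
  have hji := hij.symm
  let T := transvectionUnit hji (fourierMonomial (m - n : ℕ) (-(c * ↑b⁻¹)))
  have : T.1.mulVec (φ b) ∈ closure (columnOrbit C(AddCircle (1 : ℝ), R) l) := by
    refine ih (n + (m - 1)) (by omega) n (m - 1) i j _ rfl hij ?_ ?_
    · rw [transvectionUnit_mulVec_of_ne _ hij, hφi]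
      exact add_mem (fourierDegreeLT_mono (by omega) ha) (fourierMonomial_mem (by omega) _)
    · rw [transvectionUnit_mulVec_same, hφi, hφj, mul_add, fourierMonomial_mul, neg_mul,
        mul_assoc, Units.inv_mul, mul_one, ← Nat.cast_add, Nat.sub_add_cancel hnm,
        Nat.sub_add_cancel (by omega : 1 ≤ m)]
      have h1 := fourierMonomial_mul_mem (m - n) (-(c * ↑b⁻¹)) ha
      rw [Nat.sub_add_cancel hnm] at h1
      convert add_mem hc h1 using 1
      simp only [map_neg]
      abel
  simpa using mulVec_mem_closure_columnOrbit T⁻¹ this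

theorem dense_columnOrbit (hR : Dense {a : R | IsUnit a}) (l : ι) [Nontrivial ι] :
    Dense (columnOrbit C(AddCircle (1 : ℝ), R) l) := by
  obtain ⟨i, j, hij⟩ := exists_pair_ne ι
  intro v
  have key : ∀ p ∈ fourierLaurent R, ∀ q ∈ fourierLaurent R,
      Function.update (Function.update v i p) j q ∈
        closure (columnOrbit C(AddCircle (1 : ℝ), R) l) := by
    intro p hp q hq
    obtain ⟨N, hN⟩ := exists_fourierMonomial_mul_mem hp
    obtain ⟨K, hK⟩ := exists_fourierMonomial_mul_mem hq
    obtain ⟨M, hM⟩ := hN (max N K) (by omega)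
    obtain ⟨M', hM'⟩ := hK (max N K) (by omega)
    obtain ⟨z, hz⟩ := isUnit_fourierMonomial (max N K : ℕ) (isUnit_one (M := R))
    have hz' : ∀ f : C(AddCircle (1 : ℝ), R), f * z = z * f := fun f => by
      rw [hz]; exact (commute_fourierMonomial_one _ f).symm
    have := mem_closure_columnOrbit_of_degree hR l (M + M') M M' i j
      (fun k => Function.update (Function.update v i p) j q k * z) rfl hij
      (by
        simp only [Function.update_of_ne hij, Function.update_self, hz']
        rw [hz]
        exact fourierDegreeLT_mono (Nat.le_succ _) hM)
      (by
        simp only [Function.update_self, hz']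
        rw [hz]
        exact fourierDegreeLT_mono (Nat.le_succ _) hM')
    simpa using mul_unit_mem_closure_columnOrbit z⁻¹ this
  let φ : C(AddCircle (1 : ℝ), R) × C(AddCircle (1 : ℝ), R) → ι → C(AddCircle (1 : ℝ), R) :=
    fun x => Function.update (Function.update v i x.1) j x.2
  have hφ : Continuous φ := ((continuous_const (y := v)).update i continuous_fst).update j continuous_snd
  have hd := (dense_fourierLaurent (R := R)).prod (dense_fourierLaurent (R := R))
  have hsub : (fourierLaurent R : Set C(AddCircle (1 : ℝ), R)) ×ˢ (fourierLaurent R : Set _) ⊆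
      φ ⁻¹' closure (columnOrbit C(AddCircle (1 : ℝ), R) l) :=
    fun x hx => key x.1 hx.1 x.2 hx.2
  have := (isClosed_closure.preimage hφ).closure_subset_iff.2 hsub (hd (v i, v j))
  simpa [φ] using this

end Euclid

section Homotopy

theorem isUnit_toBlocks₁₁_inv {S m n : Type*} [Ring S] [Fintype m] [DecidableEq m] [Fintype n]
    [DecidableEq n] (Z : (Matrix (m ⊕ n) (m ⊕ n) S)ˣ) (hd : IsUnit Z.1.toBlocks₂₂) :
    IsUnit (Z⁻¹).1.toBlocks₁₁ := by
  obtain ⟨d, hd⟩ := hd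
  have h1 := Z.inv_mul
  have h2 := Z.mul_inv
  rw [← Matrix.fromBlocks_toBlocks Z.1, ← Matrix.fromBlocks_toBlocks (Z⁻¹).1,
    Matrix.fromBlocks_multiply, ← Matrix.fromBlocks_one, Matrix.fromBlocks_inj] at h1 h2
  obtain ⟨h11, h12, -, -⟩ := h1
  obtain ⟨k11, -, k21, -⟩ := h2
  rw [← hd] at h12 k21
  have hq : (Z⁻¹).1.toBlocks₁₂ = -((Z⁻¹).1.toBlocks₁₁ * Z.1.toBlocks₁₂ * (d⁻¹).1) := by
    rw [eq_neg_of_add_eq_zero_left h12, Matrix.neg_mul, Matrix.mul_assoc, Units.mul_inv,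
      Matrix.mul_one, neg_neg]
  have hr : (Z⁻¹).1.toBlocks₂₁ = -((d⁻¹).1 * (Z.1.toBlocks₂₁ * (Z⁻¹).1.toBlocks₁₁)) := by
    rw [eq_neg_of_add_eq_zero_left k21, Matrix.mul_neg, ← Matrix.mul_assoc, Units.inv_mul,
      Matrix.one_mul, neg_neg]
  refine ⟨⟨_, Z.1.toBlocks₁₁ - Z.1.toBlocks₁₂ * (d⁻¹).1 * Z.1.toBlocks₂₁, ?_, ?_⟩, rfl⟩
  · rw [← h11, hq]
    rw [Matrix.mul_sub, Matrix.neg_mul, ← sub_eq_add_neg]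
    simp only [Matrix.mul_assoc]
    rfl
  · rw [← k11, hr]
    rw [Matrix.sub_mul, Matrix.mul_neg, ← sub_eq_add_neg]
    simp only [Matrix.mul_assoc]
    rfl

variable {R ι : Type*} [NormedRing R] [Fintype ι] [DecidableEq ι]

abbrev pathEval (R : Type*) [NormedRing R] (t : unitInterval) : C(unitInterval, R) →+* R where
  toFun f := f t
  map_one' := rfl
  map_mul' _ _ := rfl
  map_zero' := rfl
  map_add' _ _ := rfl

def IsNullHomotopic (W : Matrix ι ι R) : Prop :=
  ∃ X : (Matrix ι ι C(unitInterval, R))ˣ, (pathEval R 0).mapMatrix X.1 = 1 ∧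
    (pathEval R 1).mapMatrix X.1 = W

def loopToPath (R : Type*) [NormedRing R] : C(AddCircle (1 : ℝ), R) →+* C(unitInterval, R) where
  toFun f := f.comp ⟨fun t => ((t : ℝ) : AddCircle (1 : ℝ)),
    (AddCircle.continuous_mk' 1).comp continuous_subtype_val⟩
  map_one' := rfl
  map_mul' _ _ := rfl
  map_zero' := rfl
  map_add' _ _ := rfl

theorem continuous_loopToPath : Continuous (loopToPath R) :=
  ContinuousMap.continuous_precomp _

theorem pathEval_loopToPath (f : C(AddCircle (1 : ℝ), R)) :
    pathEval R 1 (loopToPath R f) = pathEval R 0 (loopToPath R f) := by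
  change f ((1 : ℝ) : AddCircle (1 : ℝ)) = f ((0 : ℝ) : AddCircle (1 : ℝ))
  rw [AddCircle.coe_period, QuotientAddGroup.mk_zero]

theorem exists_loopToPath_eq (f : C(unitInterval, R)) (hf : f 0 = f 1) :
    ∃ g, loopToPath R g = f := by
  let F : ℝ → R := Set.IccExtend zero_le_one f
  have hF : Continuous F := f.continuous.Icc_extend'
  have h01 : F 0 = F 1 := by
    simp only [F, Set.IccExtend_left, Set.IccExtend_right]
    exact hf
  refine ⟨⟨AddCircle.liftIco 1 0 F, AddCircle.liftIco_zero_continuous h01 hF.continuousOn⟩, ?_⟩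
  ext ⟨t, ht⟩
  change AddCircle.liftIco 1 0 F (t : AddCircle (1 : ℝ)) = _
  rcases ht.2.lt_or_eq with h | rfl
  · rw [AddCircle.liftIco_coe_apply (by simpa using ⟨ht.1, h⟩)]
    exact Set.IccExtend_of_mem zero_le_one f ht
  · rw [AddCircle.coe_period, ← QuotientAddGroup.mk_zero, AddCircle.liftIco_coe_apply (by simp)]
    rw [h01]
    exact Set.IccExtend_of_mem zero_le_one f ht

theorem IsNullHomotopic.reindex {κ : Type*} [Fintype κ] [DecidableEq κ] {W : Matrix ι ι R}
    (h : IsNullHomotopic W) (e : ι ≃ κ) : IsNullHomotopic (W.reindex e e) := by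
  obtain ⟨X, h0, h1⟩ := h
  refine ⟨Units.map (Matrix.reindexRingEquiv C(unitInterval, R) e).toMonoidHom X, ?_, ?_⟩
  · ext i j
    simpa [Matrix.one_apply] using congr_fun₂ h0 (e.symm i) (e.symm j)
  · ext i j
    simpa using congr_fun₂ h1 (e.symm i) (e.symm j)

theorem joinedIn_isUnit_of_isNullHomotopic {W : Matrix (Fin 1) (Fin 1) R}
    (h : IsNullHomotopic W) : JoinedIn {a : R | IsUnit a} 1 (W 0 0) := by
  obtain ⟨X, h0, h1⟩ := h
  have hX : IsUnit (X.1 0 0) :=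
    ⟨⟨X.1 0 0, (X⁻¹).1 0 0, by simpa [Matrix.mul_apply] using congr_fun₂ X.mul_inv 0 0,
      by simpa [Matrix.mul_apply] using congr_fun₂ X.inv_mul 0 0⟩, rfl⟩
  exact ⟨⟨X.1 0 0, congr_fun₂ h0 0 0, congr_fun₂ h1 0 0⟩, fun t => hX.map (pathEval R t)⟩

theorem isNullHomotopic_of_joined [StarRing R] [ContinuousStar R] {W : unitary (Matrix ι ι R)} (h : Joined 1 W) :
    IsNullHomotopic W.1 := by
  obtain ⟨p⟩ := h
  have hc : ∀ i j, Continuous fun t => (p t).1 i j := fun i j =>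
    (continuous_subtype_val.comp p.continuous).matrix_elem i j
  have h1 : ∀ i j (t : unitInterval),
      (1 : Matrix ι ι R) i j = (1 : Matrix ι ι C(unitInterval, R)) i j t := by
    intro i j t
    rw [Matrix.one_apply, Matrix.one_apply]
    split_ifs <;> rfl
  refine ⟨⟨.of fun i j => ⟨fun t => (p t).1 i j, hc i j⟩,
    .of fun i j => ⟨fun t => star ((p t).1 j i), (hc j i).star⟩, ?_, ?_⟩, ?_, ?_⟩
  · ext i j t
    rw [Matrix.mul_apply, ContinuousMap.sum_apply]
    exact (congr_fun₂ (Unitary.coe_mul_star_self (p t)) i j).trans (h1 i j t)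
  · ext i j t
    rw [Matrix.mul_apply, ContinuousMap.sum_apply]
    exact (congr_fun₂ (Unitary.coe_star_mul_self (p t)) i j).trans (h1 i j t)
  · ext i j
    change (p 0).1 i j = _
    rw [p.source]
    rfl
  · ext i j
    change (p 1).1 i j = _
    rw [p.target]

variable [NormedAlgebra ℂ R] [CompleteSpace R]

theorem isNullHomotopic_of_fromBlocks [Nonempty ι] (hR : Dense {a : R | IsUnit a})
    {W : Matrix ι ι R}
    (h : IsNullHomotopic (Matrix.fromBlocks W 0 0 (1 : Matrix (Fin 1) (Fin 1) R))) :
    IsNullHomotopic W := by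
  obtain ⟨X, hX0, hX1⟩ := h
  let l : ι ⊕ Fin 1 := Sum.inr 0
  have : Nontrivial (ι ⊕ Fin 1) := ⟨Sum.inl (Classical.arbitrary ι), l, by simp [l]⟩
  have hloop : ∀ i, X.1 i l 0 = X.1 i l 1 := by
    intro i
    have h0 := congr_fun₂ hX0 i l
    have h1 := congr_fun₂ hX1 i l
    simp only [RingHom.mapMatrix_apply, Matrix.map_apply] at h0 h1
    refine h0.trans (Eq.trans ?_ h1.symm)
    rw [← Matrix.fromBlocks_one]
    rcases i with i | i <;> rfl
  choose v hv using fun i => exists_loopToPath_eq (X.1 i l) (hloop i)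
  let Ψ : (ι ⊕ Fin 1 → C(AddCircle (1 : ℝ), R)) → C(unitInterval, R) :=
    fun w => (X⁻¹).1.mulVec (fun i => loopToPath R (w i)) l
  have hΨ : Continuous Ψ := by
    have := continuous_loopToPath (R := R)
    simp only [Ψ, Matrix.mulVec, dotProduct]
    fun_prop
  have hΨv : Ψ v = 1 := by
    simp only [Ψ, hv]
    have := congr_fun₂ X.inv_mul l l
    simpa [Matrix.mul_apply, Matrix.mulVec, dotProduct] using this
  obtain ⟨_, ⟨F, rfl⟩, hFu⟩ := (dense_columnOrbit hR l).exists_mem_open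
    (Units.isOpen.preimage hΨ) ⟨v, by simp [hΨv]⟩
  let F' : (Matrix (ι ⊕ Fin 1) (ι ⊕ Fin 1) C(unitInterval, R))ˣ :=
    Units.map (loopToPath R).mapMatrix.toMonoidHom F
  have hF' : (pathEval R 1).mapMatrix (F'⁻¹).1 = (pathEval R 0).mapMatrix (F'⁻¹).1 := by
    ext i j
    exact pathEval_loopToPath _
  have hZ : IsUnit (X⁻¹ * F').1.toBlocks₂₂ := by
    have h1 : (X⁻¹ * F').1.toBlocks₂₂ =
        Matrix.scalar (Fin 1) (Ψ (F.1.mulVec (Pi.single l 1))) := by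
      ext1 i j
      rw [Subsingleton.elim i 0, Subsingleton.elim j 0]
      simp [Ψ, Matrix.mul_apply, Matrix.mulVec, dotProduct, F', l, Matrix.toBlocks₂₂]
    rw [h1]
    exact hFu.map _
  obtain ⟨c, hc⟩ := isUnit_toBlocks₁₁_inv _ hZ
  rw [mul_inv_rev, inv_inv, Units.val_mul] at hc
  have hc0 : (pathEval R 0).mapMatrix c.1 =
      Matrix.toBlocks₁₁ ((pathEval R 0).mapMatrix (F'⁻¹).1) := by
    have : (pathEval R 0).mapMatrix c.1 =
        Matrix.toBlocks₁₁ ((pathEval R 0).mapMatrix ((F'⁻¹).1 * X.1)) := by rw [hc]; rfl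
    rw [this, map_mul, hX0, mul_one]
  have hc1 : (pathEval R 1).mapMatrix c.1 =
      Matrix.toBlocks₁₁ ((pathEval R 0).mapMatrix (F'⁻¹).1) * W := by
    have : (pathEval R 1).mapMatrix c.1 =
        Matrix.toBlocks₁₁ ((pathEval R 1).mapMatrix ((F'⁻¹).1 * X.1)) := by rw [hc]; rfl
    rw [this, map_mul, hX1, hF']
    rw [← Matrix.fromBlocks_toBlocks ((pathEval R 0).mapMatrix (F'⁻¹).1),
      Matrix.fromBlocks_multiply]
    simp
  let c0 : (Matrix ι ι R)ˣ := Units.map (pathEval R 0).mapMatrix.toMonoidHom c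
  let K : R →+* C(unitInterval, R) :=
    { toFun := ContinuousMap.const _
      map_one' := rfl
      map_mul' := fun _ _ => rfl
      map_zero' := rfl
      map_add' := fun _ _ => rfl }
  refine ⟨Units.map K.mapMatrix.toMonoidHom c0⁻¹ * c, ?_, ?_⟩
  · rw [Units.val_mul, map_mul]
    exact c0.inv_mul
  · rw [Units.val_mul, map_mul, hc1, ← hc0, ← mul_assoc]
    exact (congr_arg (· * W) c0.inv_mul).trans (one_mul _)

theorem isNullHomotopic_of_stable [Nonempty ι] (hR : Dense {a : R | IsUnit a})
    {W : Matrix ι ι R} (k : ℕ)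
    (h : IsNullHomotopic (Matrix.fromBlocks W 0 0 (1 : Matrix (Fin k) (Fin k) R))) :
    IsNullHomotopic W := by
  induction k with
  | zero =>
    convert h.reindex (Equiv.sumEmpty ι (Fin 0))
    ext i j
    simp
  | succ k ih =>
    refine ih (isNullHomotopic_of_fromBlocks hR ?_)
    convert h.reindex (((Equiv.refl ι).sumCongr finSumFinEquiv.symm).trans
      (Equiv.sumAssoc ι (Fin k) (Fin 1)).symm)
    ext i j
    rcases i with (i | i) | i <;> rcases j with (j | j) | j <;>
      simp [Matrix.one_apply]
    · exact fun h => absurd (congr_arg Fin.val h) (by simp; omega)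
    · exact fun h => absurd (congr_arg Fin.val h) (by simp; omega)

end Homotopy

section Polar

variable {S : Type*} [CStarAlgebra S] [PartialOrder S] [StarOrderedRing S]

theorem isUnit_cfcAbs {a : S} (ha : IsUnit a) : IsUnit (CFC.abs a) := by
  have h : IsUnit (CFC.abs a * CFC.abs a) := by
    rw [CFC.abs_mul_abs]
    exact ha.star.mul ha
  exact ((Commute.refl (CFC.abs a)).isUnit_mul_iff.1 h).1

def polarPart (a : S) : S := a * Ring.inverse (CFC.abs a)

theorem polarPart_mul_abs {a : S} (ha : IsUnit a) : polarPart a * CFC.abs a = a := by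
  rw [polarPart, mul_assoc, Ring.inverse_mul_cancel _ (isUnit_cfcAbs ha), mul_one]

theorem polarPart_mem_unitary {a : S} (ha : IsUnit a) : polarPart a ∈ unitary S := by
  have h := isUnit_cfcAbs ha
  have hv : IsUnit (polarPart a) := ha.mul (h.ringInverse)
  have h1 : star (polarPart a) * polarPart a = 1 := by
    rw [polarPart, star_mul, ← Ring.inverse_star,
      (IsSelfAdjoint.of_nonneg (CFC.abs_nonneg a)).star_eq, mul_assoc, ← mul_assoc (star a),
      ← CFC.abs_mul_abs, mul_assoc, Ring.mul_inverse_cancel _ h, mul_one,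
      Ring.inverse_mul_cancel _ h]
  refine Unitary.mem_iff.2 ⟨h1, ?_⟩
  obtain ⟨v, hv⟩ := hv
  rw [← hv] at h1 ⊢
  have h2 : star v.1 = v⁻¹.1 := Units.eq_inv_of_mul_eq_one_right h1
  rw [h2, Units.mul_inv]

theorem polarPart_of_mem_unitary {U : S} (hU : U ∈ unitary S) : polarPart U = U := by
  rw [polarPart, CFC.abs_of_mem_unitary hU, Ring.inverse_one, mul_one]

theorem continuousOn_polarPart : ContinuousOn (polarPart (S := S)) {a | IsUnit a} := by
  intro a ha
  obtain ⟨u, hu⟩ := isUnit_cfcAbs ha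
  have h1 : ContinuousAt (fun a : S => Ring.inverse (CFC.abs a)) a :=
    ContinuousAt.comp (g := Ring.inverse) (by rw [← hu]; exact NormedRing.inverse_continuousAt u)
      CFC.continuous_abs.continuousAt
  exact (continuousAt_id.mul h1).continuousWithinAt

theorem joinedIn_unitary {U : S} (hU : U ∈ unitary S) (h : JoinedIn {a : S | IsUnit a} 1 U) :
    JoinedIn (unitary S : Set S) 1 U := by
  have := h.map_continuousOn (continuousOn_polarPart)
  rw [polarPart_of_mem_unitary hU, polarPart_of_mem_unitary (one_mem _)] at this
  refine this.mono ?_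
  rintro _ ⟨a, ha, rfl⟩
  exact polarPart_mem_unitary ha

end Polar

section StableRank

variable {A : Type*} [NonUnitalCStarAlgebra A]

theorem Unitization.fst_ne_zero_of_isUnit {x : Unitization ℂ A} (h : IsUnit x) : x.fst ≠ 0 :=
  (h.map (Unitization.fstHom ℂ A)).ne_zero

theorem IsUnit.smul_of_ne_zero {S : Type*} [Ring S] [Algebra ℂ S] {c : ℂ} (hc : c ≠ 0) {x : S}
    (hx : IsUnit x) : IsUnit (c • x) := by
  rw [Algebra.smul_def]
  exact ((Units.mk0 c hc).isUnit.map (algebraMap ℂ S)).mul hx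

theorem Unitization.eq_one_add_inr {x : Unitization ℂ A} (h : x.fst = 1) : x = 1 + (x.snd : Unitization ℂ A) := by
  ext <;> simp [h]

theorem StableRankOne.exists_isUnit (h : StableRankOne A) (a : A) {ε : ℝ} (hε : 0 < ε) :
    ∃ a' : A, ‖a' - a‖ < ε ∧ IsUnit (1 + a' : Unitization ℂ A) := by
  let N : Unitization ℂ A → Unitization ℂ A := fun x => x.fst⁻¹ • x
  have hN : ContinuousAt N (1 + a) :=
    (Unitization.continuous_fst.continuousAt.inv₀ (by simp)).smul continuousAt_id
  have hmem : N ⁻¹' Metric.ball (1 + (a : Unitization ℂ A)) ε ∈ nhds (1 + (a : Unitization ℂ A)) := by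
    refine hN.preimage_mem_nhds ?_
    simpa [N] using Metric.ball_mem_nhds _ hε
  obtain ⟨x, hx, hxu⟩ := mem_closure_iff_nhds.1 (h (1 + a)) _ hmem
  have h0 := Unitization.fst_ne_zero_of_isUnit hxu
  have h1 := Unitization.eq_one_add_inr (x := N x) (by simp [N, h0])
  refine ⟨(N x).snd, ?_, ?_⟩
  · rw [Set.mem_preimage, mem_ball_iff_norm, h1, add_sub_add_left_eq_sub, ← Unitization.inr_sub,
      Unitization.norm_inr] at hx
    exact hx
  · rw [← h1]
    exact IsUnit.smul_of_ne_zero (inv_ne_zero h0) hxu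

theorem stableRankOne_of_exists_isUnit
    (h : ∀ (a : A) (ε : ℝ), 0 < ε → ∃ a' : A, ‖a' - a‖ < ε ∧ IsUnit (1 + a' : Unitization ℂ A)) :
    StableRankOne A := by
  have h1 : ∀ x : Unitization ℂ A, x.fst ≠ 0 → x ∈ closure {x : Unitization ℂ A | IsUnit x} := by
    intro x hx
    have h2 : x.fst⁻¹ • x ∈ closure {x : Unitization ℂ A | IsUnit x} := by
      rw [Unitization.eq_one_add_inr (x := x.fst⁻¹ • x) (by simp [hx]), Metric.mem_closure_iff]
      intro ε hε
      obtain ⟨a', ha, hu⟩ := h (x.fst⁻¹ • x).snd ε hε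
      refine ⟨_, hu, ?_⟩
      rwa [dist_comm, dist_eq_norm, add_sub_add_left_eq_sub, ← Unitization.inr_sub,
        Unitization.norm_inr]
    have := map_mem_closure (f := fun y => x.fst • y) (continuous_const_smul _) h2
      (t := {x : Unitization ℂ A | IsUnit x}) fun y hy => IsUnit.smul_of_ne_zero hx hy
    simpa [hx] using this
  intro x
  by_cases hx : x.fst = 0
  · have h3 : Filter.Tendsto (fun c : ℂ => x + algebraMap ℂ _ c) (nhdsWithin 0 {0}ᶜ) (nhds x) := by
      have : Continuous (fun c : ℂ => x + algebraMap ℂ (Unitization ℂ A) c) := by fun_prop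
      simpa using (this.tendsto 0).mono_left nhdsWithin_le_nhds
    refine isClosed_closure.mem_of_tendsto h3 ?_
    filter_upwards [self_mem_nhdsWithin] with c hc
    exact h1 _ (by simpa [hx, Unitization.algebraMap_eq_inl] using hc)
  · exact h1 x hx

theorem isUnit_one_add_mul_comm {S : Type*} [Ring S] {x y : S} (h : IsUnit (1 + x * y)) :
    IsUnit (1 + y * x) := by
  obtain ⟨u, hu⟩ := h
  have h1 : x * y = u - 1 := by rw [hu]; abel
  refine ⟨⟨1 + y * x, 1 - y * (u⁻¹).1 * x, ?_, ?_⟩, rfl⟩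
  · have : y * x * (y * (u⁻¹).1 * x) = y * (x * y) * (u⁻¹).1 * x := by noncomm_ring
    rw [mul_sub, mul_one, add_mul, one_mul, this, h1]
    have : y * (u.1 - 1) * (u⁻¹).1 * x = y * (u * (u⁻¹).1) * x - y * (u⁻¹).1 * x := by noncomm_ring
    rw [this, u.mul_inv]
    noncomm_ring
  · have : y * (u⁻¹).1 * x * (y * x) = y * (u⁻¹).1 * (x * y) * x := by noncomm_ring
    rw [sub_mul, one_mul, mul_add, mul_one, this, h1]
    have : y * (u⁻¹).1 * (u.1 - 1) * x = y * ((u⁻¹).1 * u) * x - y * (u⁻¹).1 * x := by noncomm_ring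
    rw [this, u.inv_mul]
    noncomm_ring

variable (D : NonUnitalStarSubalgebra ℂ A) [hD : IsClosed (D : Set A)]

theorem isUnit_one_add_of_hereditary (hher : ∀ b ∈ D, ∀ a : A, ∀ b' ∈ D, b * a * b' ∈ D) (d : D)
    (h : IsUnit (1 + (d : A) : Unitization ℂ A)) : IsUnit (1 + d : Unitization ℂ D) := by
  obtain ⟨u, hu⟩ := h
  have h1 : ((u⁻¹).1).fst = 1 := by
    have := congr_arg (fun x : Unitization ℂ A => x.fst) u.mul_inv
    rw [hu] at this
    simpa using this
  have h2 := Unitization.eq_one_add_inr h1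
  set d' := ((u⁻¹).1).snd
  have h3 := u.mul_inv
  have h4 := u.inv_mul
  rw [hu, h2] at h3 h4
  have h5 : (d : A) + d' + d * d' = 0 := by
    have := congr_arg (fun x : Unitization ℂ A => x.snd) h3
    simp [add_mul, mul_add] at this
    rw [← this]; abel
  have h6 : (d : A) + d' + d' * d = 0 := by
    have := congr_arg (fun x : Unitization ℂ A => x.snd) h4
    simp [add_mul, mul_add] at this
    rw [← this]; abel
  have h7 : d' ∈ D := by
    have h8 : d' = - d + d * d + d * d' * d := by
      have e1 : d' = - d - d * d' := by rw [sub_eq_add_neg]; rw [← sub_eq_zero, ← h5]; abel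
      have e2 : d' = - d - d' * d := by rw [sub_eq_add_neg]; rw [← sub_eq_zero, ← h6]; abel
      have e3 : d * d' = d * (- d - d' * d) := by rw [← e2]
      rw [mul_sub, mul_neg, ← mul_assoc] at e3
      rw [e3] at e1
      rw [← sub_eq_zero] at e1 ⊢
      rw [← e1]; abel
    rw [h8]
    exact add_mem (add_mem (neg_mem d.2) (mul_mem d.2 d.2)) (hher _ d.2 _ _ d.2)
  refine ⟨⟨1 + d, 1 + ((⟨d', h7⟩ : D) : Unitization ℂ D), ?_, ?_⟩, rfl⟩
  · ext
    · simp
    · simp [add_mul, mul_add]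
      rw [← h5]; abel
  · ext
    · simp
    · simp [add_mul, mul_add]
      rw [← h6]; abel

theorem tendsto_mul_of_tendsto_mul_right {X E : Type*} [NonUnitalNormedRing E] {l : Filter X}
    {f e : X → E} {a : E} (hf : Filter.Tendsto f l (nhds a)) (he : ∀ᶠ x in l, ‖e x‖ ≤ 1)
    (ha : Filter.Tendsto (fun x => a * e x) l (nhds a)) :
    Filter.Tendsto (fun x => f x * e x) l (nhds a) := by
  have h1 : Filter.Tendsto (fun x => (f x - a) * e x) l (nhds 0) :=
    Filter.Tendsto.zero_mul_isBoundedUnder_le (by simpa using hf.sub_const a) ⟨1, he⟩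
  simpa [sub_mul] using h1.add ha

theorem tendsto_mul_of_tendsto_mul_left {X E : Type*} [NonUnitalNormedRing E] {l : Filter X}
    {f e : X → E} {a : E} (hf : Filter.Tendsto f l (nhds a)) (he : ∀ᶠ x in l, ‖e x‖ ≤ 1)
    (ha : Filter.Tendsto (fun x => e x * a) l (nhds a)) :
    Filter.Tendsto (fun x => e x * f x) l (nhds a) := by
  have h1 : Filter.Tendsto (fun x => e x * (f x - a)) l (nhds 0) :=
    Filter.isBoundedUnder_le_mul_tendsto_zero ⟨1, he⟩ (by simpa using hf.sub_const a)
  simpa [mul_sub] using h1.add ha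

theorem stableRankOne_of_hereditary (hA : StableRankOne A)
    (hher : ∀ b ∈ D, ∀ a : A, ∀ b' ∈ D, b * a * b' ∈ D) : StableRankOne D := by
  refine stableRankOne_of_exists_isUnit fun d ε hε => ?_
  let _ : PartialOrder D := CStarAlgebra.spectralOrder D
  have _ : StarOrderedRing D := CStarAlgebra.spectralOrderedRing D
  let l := CStarAlgebra.approximateUnit D
  have hl : l.IsIncreasingApproximateUnit := CStarAlgebra.increasingApproximateUnit D
  have := hl.neBot
  let j : D → Unitization ℂ A := fun e => ((e : A) : Unitization ℂ A)
  have hj : Continuous j := Unitization.continuous_inr.comp continuous_subtype_val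
  have hjm : ∀ x y, j (x * y) = j x * j y := fun x y => by simp [j]
  let n : D → A → Unitization ℂ A := fun e c => (c : Unitization ℂ A) - c * j e * j e
  let y : D → A → Unitization ℂ A := fun e c => Ring.inverse (1 + n e c) * c
  have hbd : ∀ᶠ e in l, ‖j e‖ ≤ 1 := by
    filter_upwards [hl.eventually_norm] with e he
    rwa [Unitization.norm_inr]
  have hr : Filter.Tendsto (fun e : D => j d * j e) l (nhds (j d)) := by
    simpa only [hjm, Function.comp_def] using (hj.tendsto d).comp (hl.tendsto_mul_left d)
  have hl' : Filter.Tendsto (fun e : D => j e * j d) l (nhds (j d)) := by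
    simpa only [hjm, Function.comp_def] using (hj.tendsto d).comp (hl.tendsto_mul_right d)
  have hee : Filter.Tendsto (fun e : D => j d * j e * j e) l (nhds (j d)) :=
    tendsto_mul_of_tendsto_mul_right hr hbd hr
  have hN1 : Filter.Tendsto (fun e : D => 1 + n e d) l (nhds 1) := by
    simpa using (tendsto_const_nhds (x := (1 : Unitization ℂ A))).add
      ((tendsto_const_nhds (x := j d)).sub hee)
  have hy : Filter.Tendsto (fun e : D => y e d) l (nhds (j d)) := by
    have h1 := (NormedRing.inverse_continuousAt (1 : (Unitization ℂ A)ˣ)).tendsto.comp hN1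
    rw [Units.val_one, Ring.inverse_one] at h1
    simpa [y, Function.comp_def] using h1.mul_const (j d)
  have heye : Filter.Tendsto (fun e : D => j e * y e d * j e) l (nhds (j d)) :=
    tendsto_mul_of_tendsto_mul_right (tendsto_mul_of_tendsto_mul_left hy hbd hl') hbd hr
  obtain ⟨e, he1, he2⟩ := ((heye.eventually (Metric.ball_mem_nhds _ hε)).and
    (hN1.eventually (Units.nhds 1))).exists
  have hcn : Continuous fun c : A => 1 + n e c := by
    have := Unitization.continuous_inr (𝕜 := ℂ) (A := A)
    fun_prop
  have hcont : ContinuousAt (fun c : A => j e * y e c * j e) (d : A) := by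
    obtain ⟨u, hu⟩ := he2
    have h1 : ContinuousAt (fun c : A => Ring.inverse (1 + n e c)) (d : A) :=
      ContinuousAt.comp (g := Ring.inverse)
        (by rw [← hu]; exact NormedRing.inverse_continuousAt u) hcn.continuousAt
    exact (continuousAt_const.mul (h1.mul Unitization.continuous_inr.continuousAt)).mul
      continuousAt_const
  have hev := (hcont.eventually (Metric.isOpen_ball.mem_nhds he1)).and
    (hcn.continuousAt.eventually (Units.isOpen.mem_nhds he2))
  obtain ⟨δ, hδ, hball⟩ := Metric.eventually_nhds_iff.1 hev
  obtain ⟨c, hc, hcu⟩ := hA.exists_isUnit (d : A) hδ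
  obtain ⟨hc1, hc2⟩ := hball (by rwa [dist_eq_norm])
  have hyc : (y e c).fst = 0 := by simp [y]
  have hyc' : y e c = ((y e c).snd : Unitization ℂ A) := by ext <;> simp [hyc]
  have hd' : (e : A) * (y e c).snd * e ∈ D := hher _ e.2 _ _ e.2
  have hjd : (((e : A) * (y e c).snd * e : A) : Unitization ℂ A) = j e * y e c * j e := by
    rw [Unitization.inr_mul, Unitization.inr_mul, ← hyc']
  refine ⟨⟨_, hd'⟩, ?_, isUnit_one_add_of_hereditary D hher _ ?_⟩
  · rw [dist_eq_norm, ← hjd, ← Unitization.inr_sub, Unitization.norm_inr] at hc1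
    exact hc1
  · change IsUnit (1 + (((e : A) * (y e c).snd * e : A) : Unitization ℂ A))
    rw [hjd, mul_assoc]
    refine isUnit_one_add_mul_comm ?_
    have h2 : 1 + y e c * j e * j e = Ring.inverse (1 + n e c) * (1 + (c : Unitization ℂ A)) := by
      have h3 : (1 + (c : Unitization ℂ A)) = (1 + n e c) + c * j e * j e := by
        simp only [n]; abel
      rw [h3, mul_add, Ring.inverse_mul_cancel _ hc2]
      simp only [y, mul_assoc]
    rw [h2]
    exact hc2.ringInverse.mul hcu

end StableRank

section UnitPaths

open scoped ComplexOrder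

theorem isUnit_convexCombination {S : Type*} [CStarAlgebra S] [PartialOrder S] [StarOrderedRing S]
    {a b : S} (ha : 0 ≤ a) (hb : 0 ≤ b) (ha' : IsUnit a) (hb' : IsUnit b) {t : ℝ} (h0 : 0 ≤ t)
    (h1 : t ≤ 1) : IsUnit ((1 - t) • a + t • b) := by
  rcases h0.eq_or_lt with rfl | h0
  · simpa using ha'
  · refine (IsStrictlyPositive.nonneg_add (smul_nonneg (by linarith) ha) ?_).isUnit
    exact IsStrictlyPositive.smul h0 ⟨hb, hb'⟩

theorem isUnit_of_mem_unitary {S : Type*} [Monoid S] [StarMul S] {a : S} (ha : a ∈ unitary S) :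
    IsUnit a :=
  ⟨⟨a, star a, Unitary.mul_star_self_of_mem ha, Unitary.star_mul_self_of_mem ha⟩, rfl⟩

theorem JoinedIn.of_convexCombination {E : Type*} [NormedAddCommGroup E] [NormedSpace ℝ E] {F : Set E} {x y : E}
    (h : ∀ t : ℝ, 0 ≤ t → t ≤ 1 → (1 - t) • x + t • y ∈ F) : JoinedIn F x y := by
  refine JoinedIn.ofLine (f := fun t : ℝ => (1 - t) • x + t • y) (by fun_prop) (by simp) (by simp) ?_
  rintro _ ⟨t, ht, rfl⟩
  exact h t ht.1 ht.2

variable {A : Type*} [NonUnitalCStarAlgebra A]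

theorem fst_abs_eq_one [PartialOrder (Unitization ℂ A)] [StarOrderedRing (Unitization ℂ A)]
    {x : Unitization ℂ A} (hx : x.fst = 1) : (CFC.abs x).fst = 1 := by
  let φ : Unitization ℂ A →⋆ₐ[ℂ] ℂ :=
    { Unitization.fstHom ℂ A with map_star' := fun _ => rfl }
  have h1 : 0 ≤ φ (CFC.abs x) := map_nonneg φ (CFC.abs_nonneg x)
  have h2 : φ (CFC.abs x) * φ (CFC.abs x) = 1 := by
    have h3 : φ x = 1 := hx
    rw [← map_mul, CFC.abs_mul_abs, map_mul, map_star, h3, star_one, one_mul]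
  rcases mul_self_eq_one_iff.1 h2 with h | h
  · exact h
  · rw [h] at h1
    exact absurd h1 (by simp [Complex.le_def])

theorem fst_polarPart_eq_one [PartialOrder (Unitization ℂ A)] [StarOrderedRing (Unitization ℂ A)]
    {x : Unitization ℂ A} (hx : x.fst = 1) (hxu : IsUnit x) : (polarPart x).fst = 1 := by
  have := congr_arg (fun x : Unitization ℂ A => x.fst) (polarPart_mul_abs hxu)
  simpa [fst_abs_eq_one hx, hx] using this

theorem joinedIn_unitary_fst_eq_one (hA : StableRankOne A) (hK : K1Trivial A)
    {U : Unitization ℂ A} (hU : U ∈ unitary (Unitization ℂ A)) (hU1 : U.fst = 1) :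
    JoinedIn {w : Unitization ℂ A | w ∈ unitary (Unitization ℂ A) ∧ w.fst = 1} 1 U := by
  let _ : PartialOrder (Unitization ℂ A) := CStarAlgebra.spectralOrder _
  have _ : StarOrderedRing (Unitization ℂ A) := CStarAlgebra.spectralOrderedRing _
  let W : unitary (Matrix (Fin 1) (Fin 1) (Unitization ℂ A)) :=
    ⟨Matrix.of fun _ _ => U, by
      refine Unitary.mem_iff.2 ⟨?_, ?_⟩ <;> ext1 i j <;>
        rw [Subsingleton.elim i 0, Subsingleton.elim j 0] <;>
        simp [Matrix.mul_apply, Matrix.star_apply, Unitary.star_mul_self_of_mem hU,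
          Unitary.mul_star_self_of_mem hU]⟩
  obtain ⟨k, h, hJ⟩ := hK 1 one_pos W
  have h1 : JoinedIn {a : Unitization ℂ A | IsUnit a} 1 U :=
    joinedIn_isUnit_of_isNullHomotopic
      (isNullHomotopic_of_stable hA k (isNullHomotopic_of_joined hJ))
  have h2 := joinedIn_unitary hU h1
  have h3 : ∀ w ∈ unitary (Unitization ℂ A), star w.fst * w.fst = 1 := by
    intro w hw
    have := congr_arg (fun x : Unitization ℂ A => x.fst) (Unitary.star_mul_self_of_mem hw)
    simpa using this
  have h4 := h2.map_continuousOn (f := fun w => star w.fst • w)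
    (Unitization.continuous_fst.star.smul continuous_id).continuousOn
  simp only [Unitization.fst_one, hU1, star_one, one_smul] at h4
  refine h4.mono ?_
  rintro _ ⟨w, hw, rfl⟩
  refine ⟨?_, by simpa using h3 w hw⟩
  have h5 := h3 w hw
  have h6 : w.fst * star w.fst = 1 := by rw [mul_comm]; exact h5
  refine Unitary.mem_iff.2 ⟨?_, ?_⟩
  · simp only [star_smul, star_star, smul_mul_smul_comm, h6, one_smul]
    exact Unitary.star_mul_self_of_mem hw
  · simp only [star_smul, star_star, smul_mul_smul_comm, h5, one_smul]
    exact Unitary.mul_star_self_of_mem hw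

theorem joinedIn_one_add_of_hereditary (hA : NoK1Obstructions A)
    (D : NonUnitalStarSubalgebra ℂ A) [hD : IsClosed (D : Set A)]
    (hher : ∀ b ∈ D, ∀ a : A, ∀ b' ∈ D, b * a * b' ∈ D) {d : A} (hd : d ∈ D)
    (hu : IsUnit (1 + d : Unitization ℂ A)) (hn : ‖(1 + d : Unitization ℂ A)‖ ≤ 2) :
    JoinedIn {w : Unitization ℂ A | IsUnit w ∧ ‖w‖ ≤ 2 ∧ ∃ d ∈ D, w = 1 + (d : Unitization ℂ A)}
      1 (1 + d) := by
  let _ : PartialOrder (Unitization ℂ D) := CStarAlgebra.spectralOrder _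
  have _ : StarOrderedRing (Unitization ℂ D) := CStarAlgebra.spectralOrderedRing _
  let j : Unitization ℂ D →⋆ₐ[ℂ] Unitization ℂ A :=
    Unitization.starMap (NonUnitalStarSubalgebraClass.subtype D)
  have hj : Continuous j := map_continuous j
  have hj1 : ∀ w : Unitization ℂ D, w.fst = 1 → j w = 1 + ((w.snd : A) : Unitization ℂ A) := by
    intro w hw
    conv_lhs => rw [Unitization.eq_one_add_inr hw]
    rw [map_add, map_one]
    congr 1
    exact Unitization.starMap_inr _ _
  let ω : Unitization ℂ D := 1 + ((⟨d, hd⟩ : D) : Unitization ℂ D)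
  have hω1 : ω.fst = 1 := by simp [ω]
  have hω : IsUnit ω := isUnit_one_add_of_hereditary D hher ⟨d, hd⟩ hu
  have hjω : j ω = 1 + d := by rw [hj1 _ hω1]; simp [ω]
  have hU := polarPart_mem_unitary hω
  have hU1 := fst_polarPart_eq_one hω1 hω
  have hnorm : ∀ w ∈ unitary (Unitization ℂ D), ‖j w‖ ≤ 1 := fun w hw =>
    (CStarRing.norm_of_mem_unitary (Unitary.map_mem j hw)).le
  have hp1 := (joinedIn_unitary_fst_eq_one (stableRankOne_of_hereditary D hA.1 hher)
    (hA.2 D hher) hU hU1).map hj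
  rw [map_one] at hp1
  refine JoinedIn.trans (hp1.mono ?_) ?_ (y := j (polarPart ω))
  · rintro _ ⟨w, ⟨hw, hw1⟩, rfl⟩
    refine ⟨?_, (hnorm w hw).trans one_le_two, _, w.snd.2, hj1 w hw1⟩
    exact (isUnit_of_mem_unitary hw).map j
  · rw [← hjω]
    refine JoinedIn.of_convexCombination fun t h0 h1 => ?_
    have hseg : (1 - t) • j (polarPart ω) + t • j ω =
        j ((1 - t) • polarPart ω + t • ω) := by
      rw [map_add j ((1 - t) • polarPart ω) (t • ω), map_real_smul j hj, map_real_smul j hj]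
    refine ⟨?_, ?_, ((1 - t) • polarPart ω + t • ω).snd, Subtype.property _, ?_⟩
    · rw [hseg]
      refine IsUnit.map j ?_
      have h2 : (1 - t) • polarPart ω + t • ω =
          polarPart ω * ((1 - t) • (1 : Unitization ℂ D) + t • CFC.abs ω) := by
        rw [mul_add, mul_smul_comm, mul_one, mul_smul_comm, polarPart_mul_abs hω]
      rw [h2]
      exact (isUnit_of_mem_unitary hU).mul (isUnit_convexCombination zero_le_one
        (CFC.abs_nonneg ω) isUnit_one (isUnit_cfcAbs hω) h0 h1)
    · refine (norm_add_le _ _).trans ?_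
      rw [norm_smul_of_nonneg h0, norm_smul_of_nonneg (by linarith)]
      have h3 := hnorm _ hU
      rw [← hjω] at hn
      nlinarith
    · rw [hseg]
      refine hj1 _ ?_
      simp [hU1, hω1]

end UnitPaths

section CutOff

open scoped ComplexOrder

theorem isUnit_of_norm_sub_lt_one {S : Type*} [CStarAlgebra S] {v w : S} (hv : v ∈ unitary S)
    (h : ‖w - v‖ < 1) : IsUnit w := by
  have h1 : w = v * (1 - star v * (v - w)) := by
    rw [mul_sub, ← mul_assoc, Unitary.mul_star_self_of_mem hv]; noncomm_ring
  rw [h1]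
  refine (isUnit_of_mem_unitary hv).mul (isUnit_one_sub_of_norm_lt_one ?_)
  rwa [CStarRing.norm_mem_unitary_mul _ (Unitary.star_mem hv), norm_sub_rev]

/-- Elements of the functional calculus of a positive element `h` which act as cut-offs of the
spectrum at `η`. -/
theorem exists_cutOff {S : Type*} [CStarAlgebra S] [PartialOrder S] [StarOrderedRing S] {h : S}
    (hh : 0 ≤ h) {η : ℝ} (hη : 0 < η) :
    ∃ m g k : S, ‖m‖ ≤ 1 / η ∧ h * m = 1 - g ∧ IsSelfAdjoint g ∧ ‖g‖ ≤ 1 ∧ IsSelfAdjoint k ∧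
      k * g = 0 ∧ g * k = 0 ∧ ‖(1 - k) * h‖ ≤ 2 * η := by
  have hsa : IsSelfAdjoint h := .of_nonneg hh
  have hspec : ∀ t ∈ spectrum ℝ h, 0 ≤ t := fun t ht => spectrum_nonneg_of_nonneg hh ht
  have hc : Continuous fun t : ℝ => (max t η)⁻¹ :=
    (continuous_id.max continuous_const).inv₀ fun t => (lt_max_of_lt_right hη).ne'
  have hg : Continuous fun t : ℝ => 1 - t * (max t η)⁻¹ := continuous_const.sub (continuous_id.mul hc)
  have hk : Continuous fun t : ℝ => max 0 (min 1 (t / η - 1)) := by fun_prop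
  have hgk : cfc (fun t : ℝ => max 0 (min 1 (t / η - 1))) h *
      cfc (fun t : ℝ => 1 - t * (max t η)⁻¹) h = 0 := by
    rw [← cfc_mul _ _ h hk.continuousOn hg.continuousOn, ← cfc_zero ℝ h]
    refine cfc_congr fun t ht => ?_
    rcases le_total t η with h1 | h1
    · have : t / η ≤ 1 := (div_le_one hη).2 h1
      simp [this]
    · have : t ≠ 0 := (hη.trans_le h1).ne'
      simp [h1, this]
  refine ⟨cfc (fun t : ℝ => (max t η)⁻¹) h, cfc (fun t : ℝ => 1 - t * (max t η)⁻¹) h,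
    cfc (fun t : ℝ => max 0 (min 1 (t / η - 1))) h, ?_, ?_, cfc_predicate _ _, ?_,
    cfc_predicate _ _, hgk, ?_, ?_⟩
  · refine norm_cfc_le (by positivity) fun t ht => ?_
    have h1 : 0 < max t η := lt_max_of_lt_right hη
    rw [Real.norm_of_nonneg (by positivity), one_div]
    exact inv_anti₀ hη (le_max_right _ _)
  · have hi : Continuous fun t : ℝ => t := continuous_id
    rw [cfc_sub (fun _ => 1) (fun t : ℝ => t * (max t η)⁻¹) h continuousOn_const
        (hi.mul hc).continuousOn,
      cfc_mul (fun t : ℝ => t) _ h hi.continuousOn hc.continuousOn, cfc_const_one ℝ h, cfc_id' ℝ h, sub_sub_cancel]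
  · refine norm_cfc_le zero_le_one fun t ht => ?_
    have h1 : 0 < max t η := lt_max_of_lt_right hη
    have h2 : t * (max t η)⁻¹ ≤ 1 := by
      rw [← div_eq_mul_inv, div_le_one h1]; exact le_max_left _ _
    have h3 : 0 ≤ t * (max t η)⁻¹ := mul_nonneg (hspec t ht) (by positivity)
    rw [Real.norm_of_nonneg (by linarith)]
    linarith
  · rw [(cfc_commute_cfc _ _ h).eq]; exact hgk
  · have h1 : (1 - cfc (fun t : ℝ => max 0 (min 1 (t / η - 1))) h) * h =
        cfc (fun t : ℝ => (1 - max 0 (min 1 (t / η - 1))) * t) h := by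
      rw [cfc_mul (fun t : ℝ => 1 - max 0 (min 1 (t / η - 1))) (fun t : ℝ => t) h
          (continuous_const.sub hk).continuousOn continuousOn_id,
        cfc_sub (fun _ => 1) _ h continuousOn_const hk.continuousOn, cfc_const_one ℝ h, cfc_id' ℝ h]
    rw [h1]
    refine norm_cfc_le (by positivity) fun t ht => ?_
    have h2 := hspec t ht
    have h3 : 0 ≤ 1 - max 0 (min 1 (t / η - 1)) := by simp
    rw [Real.norm_of_nonneg (mul_nonneg h3 h2)]
    rcases le_total t (2 * η) with h4 | h4
    · refine le_trans (mul_le_of_le_one_left h2 ?_) h4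
      simp
    · have : 1 ≤ t / η - 1 := by
        rw [le_sub_iff_add_le, le_div_iff₀ hη]; linarith
      simp [this, hη.le]

variable {A : Type*} [NonUnitalCStarAlgebra A]

/-- The hereditary subalgebra of elements annihilated on both sides by `k`. -/
def annihilatorSubalgebra (k : Unitization ℂ A) (hk : IsSelfAdjoint k) :
    NonUnitalStarSubalgebra ℂ A where
  carrier := {d : A | k * d = 0 ∧ d * k = 0}
  add_mem' {a b} ha hb := by simp [mul_add, add_mul, ha.1, ha.2, hb.1, hb.2]
  zero_mem' := by simp
  mul_mem' {a b} ha hb := by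
    refine ⟨?_, ?_⟩
    · rw [Unitization.inr_mul, ← mul_assoc, ha.1, zero_mul]
    · rw [Unitization.inr_mul, mul_assoc, hb.2, mul_zero]
  smul_mem' c a ha := by
    refine ⟨?_, ?_⟩
    · rw [Unitization.inr_smul, mul_smul_comm, ha.1, smul_zero]
    · rw [Unitization.inr_smul, smul_mul_assoc, ha.2, smul_zero]
  star_mem' {a} ha := by
    refine ⟨?_, ?_⟩
    · rw [Unitization.inr_star, ← hk.star_eq, ← star_mul, ha.2, star_zero]
    · rw [Unitization.inr_star, ← hk.star_eq, ← star_mul, ha.1, star_zero]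

theorem mem_annihilatorSubalgebra {k : Unitization ℂ A} {hk : IsSelfAdjoint k} {d : A} :
    d ∈ annihilatorSubalgebra k hk ↔ k * d = 0 ∧ d * k = 0 := Iff.rfl

theorem isClosed_annihilatorSubalgebra (k : Unitization ℂ A) (hk : IsSelfAdjoint k) :
    IsClosed (annihilatorSubalgebra k hk : Set A) := by
  have h1 : Continuous fun d : A => (d : Unitization ℂ A) := Unitization.continuous_inr
  exact (isClosed_eq (continuous_const.mul h1) continuous_const).inter
    (isClosed_eq (h1.mul continuous_const) continuous_const)

theorem annihilatorSubalgebra_hereditary (k : Unitization ℂ A) (hk : IsSelfAdjoint k) :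
    ∀ b ∈ annihilatorSubalgebra k hk, ∀ a : A, ∀ b' ∈ annihilatorSubalgebra k hk,
      b * a * b' ∈ annihilatorSubalgebra k hk := by
  intro b hb a b' hb'
  refine ⟨?_, ?_⟩
  · rw [Unitization.inr_mul, Unitization.inr_mul, ← mul_assoc, ← mul_assoc, hb.1, zero_mul, zero_mul]
  · rw [Unitization.inr_mul, mul_assoc, hb'.2, mul_zero]

theorem exists_joinedIn_one_of_unitary [PartialOrder (Unitization ℂ A)]
    [StarOrderedRing (Unitization ℂ A)] (hA : NoK1Obstructions A) {h : Unitization ℂ A}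
    (hh : 0 ≤ h) {η : ℝ} (hη : 0 < η) :
    ∃ κ > 0, ∀ v ∈ unitary (Unitization ℂ A), v.fst = 1 → ‖(v - 1) * h‖ ≤ κ →
      JoinedIn {w : Unitization ℂ A | IsUnit w ∧ ‖w‖ ≤ 2 ∧ ‖(w - 1) * h‖ ≤ 6 * η} 1 v := by
  obtain ⟨m, g, k, hm, hmg, hgsa, hg, hksa, hkg, hgk, hkh⟩ := exists_cutOff hh hη
  have hQ : 0 < 1 + 2 * (‖h‖ / η) := by positivity
  refine ⟨min (η / 4) (6 * η / (1 + 2 * (‖h‖ / η))), by positivity, fun v hv hv1 hvκ => ?_⟩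
  obtain ⟨hκ1, hκ2⟩ := le_min_iff.1 hvκ
  rw [le_div_iff₀ hQ] at hκ2
  set κ := ‖(v - 1) * h‖ with hκ
  have hκ0 : 0 ≤ κ := norm_nonneg _
  have hve : ‖(v - 1) * (1 - g)‖ ≤ κ * (1 / η) := by
    rw [← hmg, ← mul_assoc]
    exact (norm_mul_le _ _).trans (mul_le_mul_of_nonneg_left hm hκ0)
  have hev : ‖(1 - g) * (v - 1)‖ ≤ κ * (1 / η) := by
    have h1 : star ((1 - g) * (v - 1)) = - (star v * ((v - 1) * (1 - g))) := by
      rw [← mul_assoc, mul_sub (star v), Unitary.star_mul_self_of_mem hv, star_mul, star_sub,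
        star_sub, star_one, hgsa.star_eq]
      noncomm_ring
    rw [← norm_star, h1, norm_neg, CStarRing.norm_mem_unitary_mul _ (Unitary.star_mem hv)]
    exact hve
  set w : Unitization ℂ A := 1 + g * (v - 1) * g with hw
  have hwv : ‖w - v‖ ≤ 2 * κ / η := by
    have h1 : w - v = -((1 - g) * (v - 1) * g + (v - 1) * (1 - g)) := by
      rw [hw]; noncomm_ring
    rw [h1, norm_neg]
    refine (norm_add_le _ _).trans ?_
    have h2 := (norm_mul_le ((1 - g) * (v - 1)) g).trans
      (mul_le_of_le_one_right (norm_nonneg _) hg)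
    have h3 : 2 * κ / η = κ * (1 / η) + κ * (1 / η) := by ring
    linarith
  have hwv2 : ‖w - v‖ ≤ 1 / 2 := by
    refine hwv.trans ?_
    rw [div_le_iff₀ hη]; linarith
  have hvn : ‖v‖ ≤ 1 := (CStarRing.norm_of_mem_unitary hv).le
  have hnear : ∀ x : Unitization ℂ A, ‖x - v‖ ≤ ‖w - v‖ →
      IsUnit x ∧ ‖x‖ ≤ 2 ∧ ‖(x - 1) * h‖ ≤ 6 * η := by
    intro x hx
    refine ⟨isUnit_of_norm_sub_lt_one hv (by linarith), ?_, ?_⟩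
    · have := norm_sub_norm_le x v
      linarith
    · have h1 : (x - 1) * h = (x - v) * h + (v - 1) * h := by noncomm_ring
      rw [h1]
      refine (norm_add_le _ _).trans ?_
      have h2 := norm_mul_le (x - v) h
      have h3 : ‖x - v‖ * ‖h‖ ≤ 2 * κ / η * ‖h‖ :=
        mul_le_mul_of_nonneg_right (hx.trans hwv) (norm_nonneg _)
      have h4 : κ * (1 + 2 * (‖h‖ / η)) = 2 * κ / η * ‖h‖ + κ := by ring
      linarith
  have hseg : JoinedIn {w : Unitization ℂ A | IsUnit w ∧ ‖w‖ ≤ 2 ∧ ‖(w - 1) * h‖ ≤ 6 * η} w v := by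
    refine JoinedIn.of_convexCombination fun t h0 h1 => hnear _ ?_
    have h2 : (1 - t) • w + t • v - v = (1 - t) • (w - v) := by module
    rw [h2, norm_smul_of_nonneg (by linarith)]
    exact mul_le_of_le_one_left (norm_nonneg _) (by linarith)
  refine JoinedIn.trans ?_ hseg
  have hgvg : (g * (v - 1) * g).fst = 0 := by
    rw [Unitization.fst_mul, Unitization.fst_mul, sub_eq_add_neg, Unitization.fst_add,
      Unitization.fst_neg, hv1]
    simp
  obtain ⟨d, hd⟩ : ∃ d : A, (d : Unitization ℂ A) = g * (v - 1) * g :=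
    ⟨(g * (v - 1) * g).snd, Unitization.ext hgvg.symm rfl⟩
  have := isClosed_annihilatorSubalgebra k hksa
  have hdD : d ∈ annihilatorSubalgebra k hksa := by
    rw [mem_annihilatorSubalgebra, hd]
    refine ⟨?_, ?_⟩
    · rw [← mul_assoc, ← mul_assoc, hkg, zero_mul, zero_mul]
    · rw [mul_assoc, hgk, mul_zero]
  obtain ⟨hwu, hwn, -⟩ := hnear w le_rfl
  have hJ := joinedIn_one_add_of_hereditary hA (annihilatorSubalgebra k hksa)
    (annihilatorSubalgebra_hereditary k hksa) hdD (by rwa [hd]) (by rwa [hd])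
  rw [hd] at hJ
  refine hJ.mono ?_
  rintro x ⟨hxu, hxn, d', hd', rfl⟩
  refine ⟨hxu, hxn, ?_⟩
  have h1 : (1 + (d' : Unitization ℂ A) - 1) * h = (d' : Unitization ℂ A) * ((1 - k) * h) := by
    rw [← mul_assoc, mul_sub, (mem_annihilatorSubalgebra.1 hd').2]; noncomm_ring
  have h2 : ‖(d' : Unitization ℂ A)‖ ≤ 3 := by
    have := norm_sub_le (1 + (d' : Unitization ℂ A)) 1
    rw [add_sub_cancel_left, norm_one] at this
    linarith
  rw [h1]
  refine (norm_mul_le _ _).trans ?_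
  have := mul_le_mul h2 hkh (norm_nonneg _) (by norm_num)
  linarith

end CutOff

section LocalConnectivity

open scoped ComplexOrder

variable {A : Type*} [NonUnitalCStarAlgebra A]

/-- Invertible elements near a common (possibly singular) element `z` are joined by a path of
invertible elements which stays near `z`. -/
theorem exists_joinedIn_isUnit_near (hA : NoK1Obstructions A) (z : Unitization ℂ A) {ε : ℝ}
    (hε : 0 < ε) :
    ∃ δ > 0, ∀ x y : Unitization ℂ A, IsUnit x → IsUnit y → x.fst = 1 → y.fst = 1 →
      ‖x - z‖ < δ → ‖y - z‖ < δ →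
        JoinedIn {a : Unitization ℂ A | IsUnit a ∧ ‖a - z‖ < ε} x y := by
  let _ : PartialOrder (Unitization ℂ A) := CStarAlgebra.spectralOrder _
  have _ : StarOrderedRing (Unitization ℂ A) := CStarAlgebra.spectralOrderedRing _
  set h := CFC.abs z with hh
  have hh0 : 0 ≤ h := CFC.abs_nonneg z
  obtain ⟨η, hη, hηε⟩ : ∃ η > 0, 20 * η = ε := ⟨ε / 20, by positivity, by ring⟩
  obtain ⟨κ, hκ, hJ⟩ := exists_joinedIn_one_of_unitary hA hh0 hη
  obtain ⟨κ', hκ', hκ1, hκ2⟩ : ∃ κ' > 0, 4 * κ' ≤ κ ∧ κ' ≤ η :=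
    ⟨min (κ / 4) η, by positivity, by linarith [min_le_left (κ / 4) η], min_le_right _ _⟩
  obtain ⟨δ, hδ, hδabs⟩ := Metric.continuousAt_iff.1
    (CFC.continuous_abs (A := Unitization ℂ A)).continuousAt κ' hκ'
  set H : Unitization ℂ A := h + η • (1 : Unitization ℂ A) with hH
  have hHpos : IsStrictlyPositive H :=
    IsStrictlyPositive.nonneg_add hh0 (IsStrictlyPositive.smul hη ⟨zero_le_one, isUnit_one⟩)
  have hpolar : ∀ x : Unitization ℂ A, IsUnit x → ‖x - z‖ < min δ κ' →
      ‖polarPart x * h - x‖ ≤ κ' ∧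
        JoinedIn {a : Unitization ℂ A | IsUnit a ∧ ‖a - z‖ < ε} (polarPart x * H) x := by
    intro x hx hxz
    have h1 : ‖CFC.abs x - h‖ < κ' := by
      rw [← dist_eq_norm]
      exact hδabs (by rw [dist_eq_norm]; exact hxz.trans_le (min_le_left _ _))
    have h2 : ‖x - z‖ < κ' := hxz.trans_le (min_le_right _ _)
    have hu := polarPart_mem_unitary hx
    refine ⟨?_, JoinedIn.of_convexCombination fun t h0 ht => ?_⟩
    · have h3 : polarPart x * h - x = -(polarPart x * (CFC.abs x - h)) := by
        rw [mul_sub, polarPart_mul_abs hx]; abel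
      rw [h3, norm_neg, CStarRing.norm_mem_unitary_mul _ hu]
      exact h1.le
    · have h3 : (1 - t) • (polarPart x * H) + t • x =
          polarPart x * ((1 - t) • H + t • CFC.abs x) := by
        rw [mul_add _ ((1 - t) • H), mul_smul_comm (1 - t), mul_smul_comm t, polarPart_mul_abs hx]
      refine ⟨?_, ?_⟩
      · rw [h3]
        exact (isUnit_of_mem_unitary hu).mul (isUnit_convexCombination hHpos.nonneg
          (CFC.abs_nonneg x) hHpos.isUnit (isUnit_cfcAbs hx) h0 ht)
      · have h4 : (1 - t) • (polarPart x * H) + t • x - z =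
            (1 - t) • (polarPart x * (η • (1 : Unitization ℂ A) - (CFC.abs x - h))) + (x - z) := by
          have h5 : η • (1 : Unitization ℂ A) - (CFC.abs x - h) = H - CFC.abs x := by
            rw [hH]; abel
          rw [h5, mul_sub, polarPart_mul_abs hx]
          module
        have h6 : ‖η • (1 : Unitization ℂ A) - (CFC.abs x - h)‖ ≤ η + κ' := by
          refine (norm_sub_le _ _).trans ?_
          rw [norm_smul_of_nonneg hη.le, norm_one]
          linarith
        rw [h4]
        refine (norm_add_le _ _).trans_lt ?_
        rw [norm_smul_of_nonneg (by linarith), CStarRing.norm_mem_unitary_mul _ hu]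
        have := mul_le_of_le_one_left (norm_nonneg (η • (1 : Unitization ℂ A) - (CFC.abs x - h)))
          (show 1 - t ≤ 1 by linarith)
        linarith
  refine ⟨min δ κ', by positivity, fun x y hx hy hx1 hy1 hxz hyz => ?_⟩
  obtain ⟨hxh, hxJ⟩ := hpolar x hx hxz
  obtain ⟨hyh, hyJ⟩ := hpolar y hy hyz
  have hu := polarPart_mem_unitary hx
  have hv := polarPart_mem_unitary hy
  have hu1 := fst_polarPart_eq_one hx1 hx
  have hv1 := fst_polarPart_eq_one hy1 hy
  set u := polarPart x
  set v := polarPart y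
  have hxz' : ‖x - z‖ < κ' := hxz.trans_le (min_le_right _ _)
  have hyz' : ‖y - z‖ < κ' := hyz.trans_le (min_le_right _ _)
  have hp : ‖(star u * v - 1) * h‖ ≤ κ := by
    have h1 : (star u * v - 1) * h =
        star u * ((v * h - y) + (y - z) - (x - z) - (u * h - x)) := by
      have h2 : (v * h - y) + (y - z) - (x - z) - (u * h - x) = v * h - u * h := by abel
      rw [h2, mul_sub, ← mul_assoc, ← mul_assoc, Unitary.star_mul_self_of_mem hu]
      noncomm_ring
    rw [h1, CStarRing.norm_mem_unitary_mul _ (Unitary.star_mem hu)]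
    have e1 := norm_sub_le ((v * h - y) + (y - z) - (x - z)) (u * h - x)
    have e2 := norm_sub_le ((v * h - y) + (y - z)) (x - z)
    have e3 := norm_add_le (v * h - y) (y - z)
    linarith
  have hJp := (hJ (star u * v) (mul_mem (Unitary.star_mem hu) hv) (by simp [hu1, hv1]) hp).map
    (f := fun w => u * w * H) (by fun_prop)
  rw [mul_one, ← mul_assoc, Unitary.mul_star_self_of_mem hu, one_mul] at hJp
  refine hxJ.symm.trans (JoinedIn.trans (hJp.mono ?_) hyJ)
  rintro _ ⟨w, ⟨hw, hwn, hwh⟩, rfl⟩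
  refine ⟨((isUnit_of_mem_unitary hu).mul hw).mul hHpos.isUnit, ?_⟩
  have h1 : u * w * H - z = u * ((w - 1) * h) + u * (η • w) + (u * h - x) + (x - z) := by
    rw [hH, mul_add, mul_smul_comm, mul_smul_comm, mul_one]
    noncomm_ring
  show ‖u * w * H - z‖ < ε
  rw [h1]
  have e1 := norm_add_le (u * ((w - 1) * h) + u * (η • w) + (u * h - x)) (x - z)
  have e2 := norm_add_le (u * ((w - 1) * h) + u * (η • w)) (u * h - x)
  have e3 := norm_add_le (u * ((w - 1) * h)) (u * (η • w))
  rw [CStarRing.norm_mem_unitary_mul _ hu, CStarRing.norm_mem_unitary_mul _ hu,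
    norm_smul_of_nonneg hη.le] at e3
  have e4 := mul_le_mul_of_nonneg_left hwn hη.le
  linarith

end LocalConnectivity

section Assembly

variable {A : Type*} [NonUnitalCStarAlgebra A]

theorem exists_joinedIn_isUnit_fst_eq_one (hA : NoK1Obstructions A) {z : Unitization ℂ A}
    (hz : z.fst = 1) {ε : ℝ} (hε : 0 < ε) :
    ∃ δ > 0, ∀ x y : Unitization ℂ A, IsUnit x → IsUnit y → x.fst = 1 → y.fst = 1 →
      ‖x - z‖ < δ → ‖y - z‖ < δ →
        JoinedIn {a : Unitization ℂ A | IsUnit a ∧ a.fst = 1 ∧ ‖a - z‖ < ε} x y := by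
  let N : Unitization ℂ A → Unitization ℂ A := fun x => x.fst⁻¹ • x
  have hN : ∀ x : Unitization ℂ A, x.fst ≠ 0 → ContinuousAt N x := fun x hx =>
    (Unitization.continuous_fst.continuousAt.inv₀ hx).smul continuousAt_id
  have hN1 : ∀ x : Unitization ℂ A, x.fst = 1 → N x = x := fun x hx => by simp [N, hx]
  obtain ⟨ε', hε', h⟩ := Metric.continuousAt_iff.1 (hN z (by simp [hz])) ε hε
  rw [hN1 z hz] at h
  obtain ⟨δ, hδ, hJ⟩ := exists_joinedIn_isUnit_near hA z hε'
  refine ⟨δ, hδ, fun x y hx hy hx1 hy1 hxz hyz => ?_⟩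
  have h1 := (hJ x y hx hy hx1 hy1 hxz hyz).map_continuousOn (f := N) fun a ha =>
    (hN a (Unitization.fst_ne_zero_of_isUnit ha.1)).continuousWithinAt
  rw [hN1 x hx1, hN1 y hy1] at h1
  refine h1.mono ?_
  rintro _ ⟨a, ⟨hau, haz⟩, rfl⟩
  have h0 := Unitization.fst_ne_zero_of_isUnit hau
  refine ⟨IsUnit.smul_of_ne_zero (inv_ne_zero h0) hau, by simp [N, h0], ?_⟩
  rw [← dist_eq_norm] at haz ⊢
  exact h haz

theorem one_add_inr_mul_one_add_inr_eq_one_iff {a b : A} :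
    (1 + a : Unitization ℂ A) * (1 + b) = 1 ↔ a + b + a * b = 0 := by
  have h1 : (1 + a : Unitization ℂ A) * (1 + b) = 1 + ((a + b + a * b : A) : Unitization ℂ A) := by
    rw [Unitization.inr_add, Unitization.inr_add, Unitization.inr_mul]; noncomm_ring
  rw [h1, add_eq_left, ← Unitization.inr_zero ℂ, Unitization.inr_injective.eq_iff]

theorem isUnit_one_add_iff_exists {a : A} :
    IsUnit (1 + a : Unitization ℂ A) ↔ ∃ b : A, a + b + a * b = 0 ∧ a + b + b * a = 0 := by
  constructor
  · rintro ⟨u, hu⟩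
    have h1 : ((u⁻¹).1).fst = 1 := by
      have := congr_arg (fun x : Unitization ℂ A => x.fst) u.mul_inv
      rw [hu] at this
      simpa using this
    have h2 := Unitization.eq_one_add_inr h1
    refine ⟨((u⁻¹).1).snd, ?_, ?_⟩
    · rw [← one_add_inr_mul_one_add_inr_eq_one_iff, ← h2, ← hu, u.mul_inv]
    · rw [add_comm a, ← one_add_inr_mul_one_add_inr_eq_one_iff, ← h2, ← hu, u.inv_mul]
  · rintro ⟨b, h1, h2⟩
    exact ⟨⟨1 + a, 1 + b, one_add_inr_mul_one_add_inr_eq_one_iff.2 h1,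
      one_add_inr_mul_one_add_inr_eq_one_iff.2 (by rwa [add_comm b])⟩, rfl⟩

theorem quasiInverse_unique {a b c : A} (h1 : a + b + b * a = 0) (h2 : a + c + a * c = 0) :
    b = c := by
  have e1 : b * a = -a - b := by rw [← sub_eq_zero, ← h1]; abel
  have e2 : a * c = -a - c := by rw [← sub_eq_zero, ← h2]; abel
  have h3 : b * (a * c) = b * a * c := (mul_assoc _ _ _).symm
  rw [e1, e2, mul_sub, sub_mul, mul_neg, neg_mul, e1, e2] at h3
  rw [← sub_eq_zero] at h3 ⊢
  rw [← h3]; abel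

/-- Extending an approximation of `f` by invertible elements across a subinterval. -/
theorem exists_continuous_extension {E : Type*} [NormedAddCommGroup E]
    {g : unitInterval → E} (hg : Continuous g) {a b : unitInterval} (hab : a < b) {y : E}
    {F : Set E} (hJ : JoinedIn F (g a) y) :
    ∃ g' : unitInterval → E, Continuous g' ∧ (∀ t ≤ a, g' t = g t) ∧ g' b = y ∧
      ∀ t, a ≤ t → g' t ∈ F := by
  obtain ⟨γ, hγ⟩ := hJ
  have hab' : 0 < (b : ℝ) - a := sub_pos.2 hab
  let q : unitInterval → ℝ := fun t => ((t : ℝ) - a) / (b - a)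
  have hq : Continuous q := by fun_prop
  have hright : ∀ t, a ≤ t → g (min t a) + γ.extend (q t) - g a = γ.extend (q t) := by
    intro t ht
    rw [min_eq_right ht]; abel
  refine ⟨fun t => g (min t a) + γ.extend (q t) - g a, ?_, fun t ht => ?_, ?_, fun t ht => ?_⟩
  · exact ((hg.comp (continuous_id.min continuous_const)).add
      (γ.continuous_extend.comp hq)).sub continuous_const
  · have h1 : q t ≤ 0 := div_nonpos_of_nonpos_of_nonneg (sub_nonpos.2 ht) hab'.le
    simp only [min_eq_left ht, γ.extend_of_le_zero h1, add_sub_cancel_right]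
  · simp only [hright b hab.le]
    have h1 : q b = 1 := div_self hab'.ne'
    rw [h1, γ.extend_one]
  · simp only [hright t ht]
    have h1 : γ.extend (q t) ∈ Set.range γ := by
      rw [← γ.extend_range]; exact ⟨_, rfl⟩
    obtain ⟨s, hs⟩ := h1
    rw [← hs]; exact hγ s

theorem exists_continuous_isUnit_near (hA : NoK1Obstructions A)
    (B : NonUnitalStarSubalgebra ℂ A) [IsClosed (B : Set A)] (hB : StableRankOne B)
    {f : unitInterval → A} (hf : Continuous f) (hf0 : f 0 ∈ B) {ε : ℝ} (hε : 0 < ε) :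
    ∃ g : unitInterval → Unitization ℂ A, Continuous g ∧
      (∃ c : B, IsUnit (1 + c : Unitization ℂ B) ∧ g 0 = 1 + (c : A)) ∧
      ∀ t, IsUnit (g t) ∧ (g t).fst = 1 ∧ ‖g t - (1 + f t)‖ < ε := by
  have hfst : ∀ s, (1 + (f s : Unitization ℂ A)).fst = 1 := fun s => by simp
  choose δ hδ hJ using fun s => exists_joinedIn_isUnit_fst_eq_one hA (hfst s) (half_pos hε)
  have hnorm : ∀ a b : A, ‖(1 + a : Unitization ℂ A) - (1 + b)‖ = ‖a - b‖ := fun a b => by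
    rw [add_sub_add_left_eq_sub, ← Unitization.inr_sub, Unitization.norm_inr]
  obtain ⟨τ, hτ0, hτm, ⟨n, hn⟩, hτc⟩ := exists_monotone_Icc_subset_open_cover_unitInterval
    (c := fun s => {t | ‖f t - f s‖ < min (δ s) ε / 2})
    (fun s => isOpen_lt (by fun_prop) continuous_const) (fun t _ => Set.mem_iUnion.2 ⟨t, by
      simpa using ⟨hδ t, hε⟩⟩)
  have key : ∀ n, ∀ ρ > 0, ∃ g : unitInterval → Unitization ℂ A, Continuous g ∧
      (∃ c : B, IsUnit (1 + c : Unitization ℂ B) ∧ g 0 = 1 + (c : A)) ∧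
      ‖g (τ n) - (1 + f (τ n))‖ < ρ ∧
      ∀ t ≤ τ n, IsUnit (g t) ∧ (g t).fst = 1 ∧ ‖g t - (1 + f t)‖ < ε := by
    intro n
    induction n with
    | zero =>
      intro ρ hρ
      obtain ⟨c, hc, hcu⟩ := hB.exists_isUnit ⟨f 0, hf0⟩ (lt_min hρ hε)
      have hc' : ‖(c : A) - f 0‖ < min ρ ε := hc
      refine ⟨fun _ => 1 + (c : A), continuous_const, ⟨c, hcu, rfl⟩, ?_, fun t ht => ?_⟩
      · rw [hτ0, hnorm]
        exact hc'.trans_le (min_le_left _ _)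
      · rw [hτ0] at ht
        obtain rfl : t = 0 := le_antisymm ht t.2.1
        refine ⟨?_, by simp, ?_⟩
        · obtain ⟨b, h1, h2⟩ := isUnit_one_add_iff_exists.1 hcu
          exact isUnit_one_add_iff_exists.2 ⟨b, congr_arg Subtype.val h1, congr_arg Subtype.val h2⟩
        · rw [hnorm]
          exact hc'.trans_le (min_le_right _ _)
    | succ n ih =>
      intro ρ hρ
      rcases (hτm n.le_succ).eq_or_lt with heq | hlt
      · rw [← heq]; exact ih ρ hρ
      obtain ⟨s, hs⟩ := hτc n
      have hs' : ∀ t, τ n ≤ t → t ≤ τ (n + 1) → ‖f t - f s‖ < min (δ s) ε / 2 :=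
        fun t h1 h2 => hs ⟨h1, h2⟩
      have hmin : min (δ s) ε ≤ δ s := min_le_left _ _
      have hmin' : min (δ s) ε ≤ ε := min_le_right _ _
      obtain ⟨g, hg, hg0, hgn, hgt⟩ := ih (δ s / 2) (half_pos (hδ s))
      obtain ⟨c, hc, hcu⟩ := hA.1.exists_isUnit (f (τ (n + 1))) (lt_min hρ (half_pos (hδ s)))
      have hg1 := hgt (τ n) le_rfl
      have h1 : ‖g (τ n) - (1 + f s)‖ < δ s := by
        have e1 := norm_add_le (g (τ n) - (1 + f (τ n))) (1 + f (τ n) - (1 + f s))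
        rw [sub_add_sub_cancel, hnorm] at e1
        linarith [hs' _ le_rfl hlt.le]
      have h2 : ‖(1 + c : Unitization ℂ A) - (1 + f s)‖ < δ s := by
        rw [hnorm]
        have e1 := norm_add_le (c - f (τ (n + 1))) (f (τ (n + 1)) - f s)
        rw [sub_add_sub_cancel] at e1
        linarith [hs' _ hlt.le le_rfl, hc.trans_le (min_le_right _ _)]
      obtain ⟨g', hg', hg'l, hg'b, hg'r⟩ := exists_continuous_extension hg hlt
        (hJ s _ _ hg1.1 hcu hg1.2.1 (by simp) h1 h2)
      refine ⟨g', hg', ?_, ?_, fun t ht => ?_⟩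
      · rwa [hg'l 0 (τ n).2.1]
      · rw [hg'b, hnorm]
        exact hc.trans_le (min_le_left _ _)
      · rcases le_total t (τ n) with h | h
        · rw [hg'l t h]; exact hgt t h
        · obtain ⟨h3, h4, h5⟩ := hg'r t h
          refine ⟨h3, h4, ?_⟩
          have e1 := norm_sub_le (g' t - (1 + f s)) (1 + f t - (1 + f s))
          rw [sub_sub_sub_cancel_right, hnorm] at e1
          linarith [hs' t h ht]
  obtain ⟨g, hg, hg0, -, hgt⟩ := key n 1 one_pos
  rw [hn n le_rfl] at hgt
  exact ⟨g, hg, hg0, fun t => hgt t t.2.2⟩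

end Assembly

theorem stmt8 (Cst : Type*) [NonUnitalCStarAlgebra Cst] (B : NonUnitalStarSubalgebra ℂ Cst)
    [IsClosed (B : Set Cst)] (hBsr : StableRankOne B) (hCsr : StableRankOne Cst)
    (hCK1 : NoK1Obstructions Cst) :
    StableRankOne (zeroFiber Cst B) := by
  refine stableRankOne_of_exists_isUnit fun f ε hε => ?_
  obtain ⟨g, hg, ⟨c, hc, hgc⟩, hgt⟩ :=
    exists_continuous_isUnit_near hCK1 B hBsr (ContinuousMap.continuous f.1) f.2 hε
  have hsnd : Continuous fun x : Unitization ℂ Cst => x.snd := Unitization.continuous_snd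
  have hg1 : ∀ t, g t = 1 + ((g t).snd : Unitization ℂ Cst) := fun t =>
    Unitization.eq_one_add_inr (hgt t).2.1
  choose b hb1 hb2 using fun t => isUnit_one_add_iff_exists.1 (by rw [← hg1 t]; exact (hgt t).1)
  have hb : b = fun t => (Ring.inverse (g t)).snd := by
    funext t
    have h1 : g t * (1 + (b t : Unitization ℂ Cst)) = 1 := by
      rw [hg1 t]; exact one_add_inr_mul_one_add_inr_eq_one_iff.2 (hb1 t)
    have h2 : Ring.inverse (g t) = 1 + (b t : Unitization ℂ Cst) := by
      simpa [h1] using Ring.inverse_mul_cancel_left (g t) (1 + (b t : Unitization ℂ Cst)) (hgt t).1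
    rw [h2]; simp
  have hbc : Continuous b := by
    rw [hb]
    refine hsnd.comp (continuous_iff_continuousAt.2 fun t => ?_)
    obtain ⟨u, hu⟩ := (hgt t).1
    refine ContinuousAt.comp (g := Ring.inverse) ?_ hg.continuousAt
    rw [← hu]
    exact NormedRing.inverse_continuousAt u
  have hc0 : (g 0).snd = c := by rw [hgc]; simp
  have hb0 : b 0 ∈ B := by
    obtain ⟨c', h1, h2⟩ := isUnit_one_add_iff_exists.1 hc
    have h3 : (c : Cst) + c' + c * c' = 0 := congr_arg Subtype.val h1
    have h4 := hb2 0
    rw [hc0] at h4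
    rw [quasiInverse_unique h4 h3]
    exact c'.2
  let a' : zeroFiber Cst B := ⟨⟨fun t => (g t).snd, hsnd.comp hg⟩, by
    show (g 0).snd ∈ B
    rw [hc0]; exact c.2⟩
  let b' : zeroFiber Cst B := ⟨⟨b, hbc⟩, hb0⟩
  refine ⟨a', ?_, isUnit_one_add_iff_exists.2 ⟨b', ?_, ?_⟩⟩
  · show ‖(a' : C(unitInterval, Cst)) - f‖ < ε
    refine (ContinuousMap.norm_lt_iff _ hε).2 fun t => ?_
    have h1 := (hgt t).2.2
    rwa [hg1 t, add_sub_add_left_eq_sub, ← Unitization.inr_sub, Unitization.norm_inr] at h1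
  · exact Subtype.ext (ContinuousMap.ext hb1)
  · exact Subtype.ext (ContinuousMap.ext hb2)
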